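/- arXiv:1407.3251 — 8 statements merged into one kernel-verified Lean document; each statement's English description precedes it below -/
import Mathlib

section
/- Let V ⊆ ℝ^{n+1} (n ≥ 1) be an open cone, k > 0, and h : V → ℝ a smooth function that is positively homogeneous of degree k (h(λx) = λ^k·h(x) for all λ > 0 and x ∈ V). Let H be a connected component of {x ∈ V : h(x) = 1} that is a closed subset of ℝ^{n+1}, and assume that for every p ∈ H the Hessian D²h_p is negative definite on ker Dh_p. Then the cone U := {λx : λ > 0, x ∈ H} is an open convex subset of ℝ^{n+1}, and the map (0,∞) × H → U, (λ, x) ↦ λx, is a bijection which is a homeomorphism onto U. -/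
open Set Filter Topology

section Cone

variable {E : Type*} [NormedAddCommGroup E] [NormedSpace ℝ E]

/-- If the Hessian of `h` at `q` is negative on the direction `v` as soon as `v ∈ ker Dh_q`,
then the restriction of `h` to the line `q + ℝ v` has no local minimum at `q`. -/
theorem not_isLocalMin_comp_line {h : E → ℝ} {q v : E} (hq : ContDiffAt ℝ 2 h q)
    (hneg : fderiv ℝ h q v = 0 → fderiv ℝ (fderiv ℝ h) q v v < 0) :
    ¬ IsLocalMin (fun t : ℝ => h (q + t • v)) 0 := by
  intro hmin
  have hline : ∀ t : ℝ, HasDerivAt (fun t : ℝ => q + t • v) v t := fun t => by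
    simpa using ((hasDerivAt_id t).smul_const v).const_add q
  have hcont : Tendsto (fun t : ℝ => q + t • v) (𝓝 0) (𝓝 q) := by
    simpa using (hline 0).continuousAt.tendsto
  have hderiv : ∀ᶠ t : ℝ in 𝓝 0, HasDerivAt (fun t : ℝ => h (q + t • v))
      (fderiv ℝ h (q + t • v) v) t := by
    filter_upwards [hcont.eventually (hq.eventually (by simp))] with t ht
    exact (ht.differentiableAt (by simp)).hasFDerivAt.comp_hasDerivAt t (hline t)
  have hderiv_eq : deriv (fun t : ℝ => h (q + t • v)) =ᶠ[𝓝 0]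
      fun t => fderiv ℝ h (q + t • v) v := hderiv.mono fun t ht => ht.deriv
  have hzero : deriv (fun t : ℝ => h (q + t • v)) 0 = 0 := hmin.deriv_eq_zero
  have hneg' : fderiv ℝ (fderiv ℝ h) q v v < 0 :=
    hneg (by simpa [hderiv_eq.eq_of_nhds] using hzero)
  have hsecond : deriv (deriv fun t : ℝ => h (q + t • v)) 0 = fderiv ℝ (fderiv ℝ h) q v v := by
    rw [hderiv_eq.deriv_eq]
    have hd : HasFDerivAt (fderiv ℝ h) (fderiv ℝ (fderiv ℝ h) q) (q + (0 : ℝ) • v) := by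
      simpa using ((hq.fderiv_right (m := 1) (by norm_num)).differentiableAt (by simp)).hasFDerivAt
    have hc : HasDerivAt (fun t : ℝ => fderiv ℝ h (q + t • v)) (fderiv ℝ (fderiv ℝ h) q v) 0 :=
      hd.comp_hasDerivAt 0 (hline 0)
    simpa using (hc.clm_apply (hasDerivAt_const 0 v)).deriv
  have hmax := isLocalMax_of_deriv_deriv_neg (hsecond ▸ hneg') hzero
    hderiv.self_of_nhds.continuousAt
  have hconst : (fun t : ℝ => h (q + t • v)) =ᶠ[𝓝 0] fun _ => h (q + (0 : ℝ) • v) := by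
    filter_upwards [hmin, hmax] with t h₁ h₂ using le_antisymm h₂ h₁
  have hvanish : deriv (deriv fun t : ℝ => h (q + t • v)) 0 = 0 := by
    rw [hconst.deriv.deriv_eq]
    simp
  rw [hsecond] at hvanish
  exact hneg'.ne hvanish

/-- A continuous function on `[0, 1]` without interior local minima is bounded below by the
minimum of its values at the endpoints. -/
theorem min_endpoints_le_of_forall_not_isLocalMin {φ : ℝ → ℝ} (hφ : ContinuousOn φ (Icc 0 1))
    (hmin : ∀ t ∈ Ioo (0 : ℝ) 1, ¬ IsLocalMin φ t) {t : ℝ} (ht : t ∈ Icc (0 : ℝ) 1) :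
    min (φ 0) (φ 1) ≤ φ t := by
  obtain ⟨s, hs, hsmin⟩ := isCompact_Icc.exists_isMinOn ⟨t, ht⟩ hφ
  have hst : φ s ≤ φ t := hsmin ht
  rcases hs.1.eq_or_lt with rfl | h0
  · exact (min_le_left _ _).trans hst
  rcases hs.2.eq_or_lt with rfl | h1
  · exact (min_le_right _ _).trans hst
  · exact absurd (hsmin.isLocalMin (Icc_mem_nhds h0 h1)) (hmin s ⟨h0, h1⟩)

/-- The truncated cone `[a, ∞) · H` over a closed set missing the origin is closed. -/
theorem isClosed_truncated_cone {H : Set E} (hH : IsClosed H) (h0 : (0 : E) ∉ H) {a : ℝ}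
    (ha : 0 < a) : IsClosed {y : E | ∃ l : ℝ, a ≤ l ∧ ∃ x ∈ H, y = l • x} := by
  refine isClosed_of_closure_subset fun y hy => ?_
  obtain ⟨u, hu, huy⟩ := mem_closure_iff_seq_limit.1 hy
  choose l hl x hx hux using hu
  have hlpos : ∀ i, 0 < l i := fun i => ha.trans_le (hl i)
  obtain ⟨s, hs, ψ, hψ, hlim⟩ := (isCompact_Icc (a := (0 : ℝ)) (b := a⁻¹)).tendsto_subseq
    (x := fun i => (l i)⁻¹) fun i => ⟨(inv_pos.2 (hlpos i)).le, inv_anti₀ ha (hl i)⟩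
  have hsy : s • y ∈ H := by
    refine hH.mem_of_tendsto (hlim.smul (huy.comp hψ.tendsto_atTop)) (Eventually.of_forall ?_)
    intro i
    simp only [Function.comp_apply]
    rw [hux (ψ i), inv_smul_smul₀ (hlpos _).ne']
    exact hx _
  have hspos : 0 < s := by
    refine hs.1.lt_of_ne ?_
    rintro rfl
    exact h0 (by simpa using hsy)
  exact ⟨s⁻¹, (le_inv_comm₀ ha hspos).2 hs.2, s • y, hsy, by rw [inv_smul_smul₀ hspos.ne']⟩

/-- A preconnected open set `U` is convex if every segment contained in `U` whose endpoints satisfy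
`c ≤ h` stays in a subset of `U` closed in the whole space which depends only on `c > 0`. -/
theorem convex_of_segments_subset_closed {U : Set E} (hU : IsOpen U) (hconn : IsPreconnected U)
    {h : E → ℝ} (hcont : ContinuousOn h U) (hpos : ∀ x ∈ U, 0 < h x) {K : ℝ → Set E}
    (hK : ∀ c, 0 < c → IsClosed (K c)) (hKU : ∀ c, 0 < c → K c ⊆ U)
    (hseg : ∀ c, 0 < c → ∀ x y, c ≤ h x → c ≤ h y → segment ℝ x y ⊆ U → segment ℝ x y ⊆ K c) :
    Convex ℝ U := by
  refine convex_iff_segment_subset.2 fun x hx => ?_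
  suffices U ⊆ {y | segment ℝ x y ⊆ U} from fun y hy => this hy
  refine hconn.subset_of_closure_inter_subset ?_ ⟨x, hx, by simpa using hx⟩ ?_
  · rw [Metric.isOpen_iff]
    intro y hy
    have hcompact : IsCompact (segment ℝ x y) := by
      rw [segment_eq_image]
      exact isCompact_Icc.image (by fun_prop)
    obtain ⟨δ, hδ, hsub⟩ := hcompact.exists_thickening_subset_open hU hy
    refine ⟨δ, hδ, fun y' hy' => ?_⟩
    rw [mem_ofPred_eq, segment_eq_image]
    rintro _ ⟨t, ht, rfl⟩
    refine hsub (Metric.mem_thickening_iff.2 ⟨(1 - t) • x + t • y, ?_, ?_⟩)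
    · rw [segment_eq_image]
      exact ⟨t, ht, rfl⟩
    · simp only [dist_add_left, dist_smul₀, Real.norm_eq_abs, abs_of_nonneg ht.1]
      exact (mul_le_of_le_one_left dist_nonneg ht.2).trans_lt hy'
  · rintro y ⟨hy, hyU⟩
    have hc : 0 < min (h x) (h y / 2) := lt_min (hpos x hx) (half_pos (hpos y hyU))
    rw [mem_ofPred_eq, segment_eq_image]
    rintro _ ⟨t, ht, rfl⟩
    refine hKU _ hc ?_
    have hlim : Tendsto (fun z : E => (1 - t) • x + t • z) (𝓝 y) (𝓝 ((1 - t) • x + t • y)) :=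
      Continuous.tendsto (by fun_prop) y
    refine (hK _ hc).mem_of_frequently_of_tendsto ?_ hlim
    have hev : ∀ᶠ z in 𝓝 y, h y / 2 < h z :=
      (hcont.continuousAt (hU.mem_nhds hyU)).eventually (lt_mem_nhds (half_lt_self (hpos y hyU)))
    refine ((mem_closure_iff_frequently.1 hy).and_eventually hev).mono ?_
    rintro z ⟨hz, hyz⟩
    refine hseg _ hc x z (min_le_left _ _) ((min_le_right _ _).trans hyz.le) hz ?_
    rw [segment_eq_image]
    exact ⟨t, ht, rfl⟩

/-- The radial projection `y ↦ h(y)^{-1/k} y` lands in the level set `{h = 1}`. -/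
theorem apply_rpow_smul_eq_one {V : Set E} {h : E → ℝ} {k : ℝ} (hk : 0 < k)
    (hhomog : ∀ l : ℝ, 0 < l → ∀ x ∈ V, h (l • x) = l ^ k * h x) {y : E} (hy : y ∈ V)
    (hpos : 0 < h y) : h (h y ^ (-k⁻¹) • y) = 1 := by
  rw [hhomog _ (Real.rpow_pos_of_pos hpos _) y hy, ← Real.rpow_mul hpos.le, neg_mul,
    inv_mul_cancel₀ hk.ne', Real.rpow_neg_one, inv_mul_cancel₀ hpos.ne']

/-- The cone over a component of the level set `{h = 1}` of a positively homogeneous function is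
the corresponding component of `{h > 0}`. -/
theorem cone_connectedComponentIn_eq {V : Set E} (hVcone : ∀ l : ℝ, 0 < l → ∀ x ∈ V, l • x ∈ V)
    {h : E → ℝ} (hcont : ContinuousOn h V) {k : ℝ} (hk : 0 < k)
    (hhomog : ∀ l : ℝ, 0 < l → ∀ x ∈ V, h (l • x) = l ^ k * h x)
    {x₀ : E} (hx₀ : x₀ ∈ {x ∈ V | h x = 1}) :
    {y | ∃ l : ℝ, 0 < l ∧ ∃ x ∈ connectedComponentIn {x ∈ V | h x = 1} x₀, y = l • x} =
      connectedComponentIn {x ∈ V | 0 < h x} x₀ := by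
  have hx₀' : x₀ ∈ {x ∈ V | 0 < h x} := ⟨hx₀.1, by rw [hx₀.2]; exact one_pos⟩
  apply Subset.antisymm
  · refine IsPreconnected.subset_connectedComponentIn (F := {x ∈ V | 0 < h x}) ?_
      ⟨1, one_pos, x₀, mem_connectedComponentIn hx₀, (one_smul _ _).symm⟩ ?_
    · have himage : {y | ∃ l : ℝ, 0 < l ∧
          ∃ x ∈ connectedComponentIn {x ∈ V | h x = 1} x₀, y = l • x} =
          (fun p : ℝ × E => p.1 • p.2) ''
            (Ioi 0 ×ˢ connectedComponentIn {x ∈ V | h x = 1} x₀) := by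
        ext y
        constructor
        · rintro ⟨l, hl, x, hx, rfl⟩
          exact ⟨(l, x), ⟨hl, hx⟩, rfl⟩
        · rintro ⟨⟨l, x⟩, ⟨hl, hx⟩, rfl⟩
          exact ⟨l, hl, x, hx, rfl⟩
      rw [himage]
      exact (isPreconnected_Ioi.prod isPreconnected_connectedComponentIn).image _
        (by fun_prop)
    · rintro _ ⟨l, hl, x, hx, rfl⟩
      obtain ⟨hxV, hx1⟩ := connectedComponentIn_subset _ _ hx
      refine ⟨hVcone l hl x hxV, ?_⟩
      rw [hhomog l hl x hxV, hx1, mul_one]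
      exact Real.rpow_pos_of_pos hl k
  · intro y hy
    obtain ⟨hyV, hypos⟩ := connectedComponentIn_subset _ _ hy
    have hr : ContinuousOn (fun z => h z ^ (-k⁻¹) • z)
        (connectedComponentIn {x ∈ V | 0 < h x} x₀) :=
      ((hcont.mono fun z hz => (connectedComponentIn_subset _ _ hz).1).rpow_const fun z hz =>
        Or.inl (connectedComponentIn_subset _ _ hz).2.ne').smul continuousOn_id
    have hsub : (fun z => h z ^ (-k⁻¹) • z) '' connectedComponentIn {x ∈ V | 0 < h x} x₀ ⊆
        connectedComponentIn {x ∈ V | h x = 1} x₀ := by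
      refine (isPreconnected_connectedComponentIn.image _ hr).subset_connectedComponentIn
        ⟨x₀, mem_connectedComponentIn hx₀', by simp [hx₀.2]⟩ ?_
      rintro _ ⟨z, hz, rfl⟩
      obtain ⟨hzV, hzpos⟩ := connectedComponentIn_subset _ _ hz
      exact ⟨hVcone _ (Real.rpow_pos_of_pos hzpos _) z hzV,
        apply_rpow_smul_eq_one hk hhomog hzV hzpos⟩
    refine ⟨h y ^ k⁻¹, Real.rpow_pos_of_pos hypos _, _, hsub ⟨y, hy, rfl⟩, ?_⟩
    rw [smul_smul, ← Real.rpow_add hypos, add_neg_cancel, Real.rpow_zero, one_smul]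

/-- Polar coordinates on the cone over a subset `H` of the level set `{h = 1}`. -/
theorem exists_cone_homeomorph {V : Set E} {h : E → ℝ}
    (hVcone : ∀ l : ℝ, 0 < l → ∀ x ∈ V, l • x ∈ V) (hcont : ContinuousOn h V) {k : ℝ} (hk : 0 < k)
    (hhomog : ∀ l : ℝ, 0 < l → ∀ x ∈ V, h (l • x) = l ^ k * h x)
    {H : Set E} (hH : H ⊆ {x ∈ V | h x = 1}) :
    ∃ φ : Ioi (0 : ℝ) × H ≃ₜ {y | ∃ l : ℝ, 0 < l ∧ ∃ x ∈ H, y = l • x},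
      ∀ p : Ioi (0 : ℝ) × H, (φ p : E) = (p.1 : ℝ) • (p.2 : E) := by
  have hVU : ∀ y ∈ {y | ∃ l : ℝ, 0 < l ∧ ∃ x ∈ H, y = l • x}, y ∈ V := by
    rintro _ ⟨l, hl, x, hx, rfl⟩
    exact hVcone l hl x (hH hx).1
  have hval : ∀ l : ℝ, 0 < l → ∀ x ∈ H, h (l • x) = l ^ k := fun l hl x hx => by
    rw [hhomog l hl x (hH hx).1, (hH hx).2, mul_one]
  have hroot : ∀ l : ℝ, 0 < l → ∀ x ∈ H, h (l • x) ^ k⁻¹ = l := fun l hl x hx => by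
    rw [hval l hl x hx, Real.rpow_rpow_inv hl.le hk.ne']
  have hrootpos : ∀ y ∈ {y | ∃ l : ℝ, 0 < l ∧ ∃ x ∈ H, y = l • x}, 0 < h y ^ k⁻¹ := by
    rintro _ ⟨l, hl, x, hx, rfl⟩
    rwa [hroot l hl x hx]
  have hproj : ∀ y ∈ {y | ∃ l : ℝ, 0 < l ∧ ∃ x ∈ H, y = l • x}, (h y ^ k⁻¹)⁻¹ • y ∈ H := by
    rintro _ ⟨l, hl, x, hx, rfl⟩
    rwa [hroot l hl x hx, inv_smul_smul₀ hl.ne']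
  have hrootcont : Continuous
      fun y : {y | ∃ l : ℝ, 0 < l ∧ ∃ x ∈ H, y = l • x} => h y ^ k⁻¹ :=
    (continuousOn_iff_continuous_domRestrict.1 (hcont.mono hVU)).rpow_const
      fun _ => Or.inr (inv_pos.2 hk).le
  refine ⟨{
    toFun := fun p => ⟨(p.1 : ℝ) • (p.2 : E), p.1, p.1.2, p.2, p.2.2, rfl⟩
    invFun := fun y => (⟨h y ^ k⁻¹, hrootpos y y.2⟩, ⟨(h y ^ k⁻¹)⁻¹ • (y : E), hproj y y.2⟩)
    left_inv := by
      rintro ⟨⟨l, hl⟩, ⟨x, hx⟩⟩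
      have hl0 : l ≠ 0 := ne_of_gt hl
      ext <;> simp [hroot l hl x hx, inv_smul_smul₀ hl0]
    right_inv := fun y => Subtype.ext (smul_inv_smul₀ (hrootpos y y.2).ne' (y : E))
    continuous_toFun := by fun_prop
    continuous_invFun := (hrootcont.subtype_mk _).prodMk
      (((hrootcont.inv₀ fun y => (hrootpos y y.2).ne').smul continuous_subtype_val).subtype_mk
        fun y => hproj y y.2) }, fun _ => rfl⟩

/-- Along a segment in the cone over a hyperbolic centroaffine hypersurface `H`, the homogeneous
function `h` is bounded below by the minimum of its values at the endpoints. -/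
theorem le_of_segment_subset_cone {V : Set E} (hVopen : IsOpen V)
    (hVcone : ∀ l : ℝ, 0 < l → ∀ x ∈ V, l • x ∈ V) {h : E → ℝ} (hsmooth : ContDiffOn ℝ 2 h V)
    {k : ℝ} (hhomog : ∀ l : ℝ, 0 < l → ∀ x ∈ V, h (l • x) = l ^ k * h x)
    {H : Set E} (hHV : H ⊆ V)
    (hhyp : ∀ p ∈ H, ∀ v : E, fderiv ℝ h p v = 0 → v ≠ 0 → fderiv ℝ (fderiv ℝ h) p v v < 0)
    {x y : E} (hseg : segment ℝ x y ⊆ {y | ∃ l : ℝ, 0 < l ∧ ∃ x ∈ H, y = l • x})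
    {z : E} (hz : z ∈ segment ℝ x y) : min (h x) (h y) ≤ h z := by
  rcases eq_or_ne x y with rfl | hxy
  · obtain rfl : z = x := by simpa using hz
    simp
  have hv : y - x ≠ 0 := sub_ne_zero.2 hxy.symm
  rw [segment_eq_image'] at hz hseg
  obtain ⟨t, ht, rfl⟩ := hz
  have hmemV : ∀ s ∈ Icc (0 : ℝ) 1, x + s • (y - x) ∈ V := fun s hs => by
    obtain ⟨l, hl, q, hq, hlq⟩ := hseg ⟨s, hs, rfl⟩
    simp only at hlq
    rw [hlq]
    exact hVcone l hl q (hHV hq)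
  have hφ : ContinuousOn (fun s : ℝ => h (x + s • (y - x))) (Icc 0 1) :=
    hsmooth.continuousOn.comp (by fun_prop) hmemV
  have hmain := min_endpoints_le_of_forall_not_isLocalMin hφ ?_ ht
  · simpa using hmain
  intro s hs hmin
  obtain ⟨l, hl, q, hq, hlq⟩ := hseg ⟨s, Ioo_subset_Icc_self hs, rfl⟩
  simp only at hlq
  refine not_isLocalMin_comp_line (hsmooth.contDiffAt (hVopen.mem_nhds (hHV hq)))
    (fun h0 => hhyp q hq (y - x) h0 hv) ?_
  have hqV : ∀ᶠ r : ℝ in 𝓝 0, q + r • (y - x) ∈ V := by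
    have hc : ContinuousAt (fun r : ℝ => q + r • (y - x)) 0 := by fun_prop
    exact hc.eventually_mem (hVopen.mem_nhds (by simpa using hHV hq))
  have hshift : Tendsto (fun r : ℝ => s + l * r) (𝓝 0) (𝓝 s) := by
    have hc : Continuous fun r : ℝ => s + l * r := by fun_prop
    simpa using hc.tendsto 0
  filter_upwards [hqV, hshift.eventually hmin] with r hrV hr
  have hscale : x + (s + l * r) • (y - x) = l • (q + r • (y - x)) := by
    rw [smul_add, ← hlq, smul_smul, add_smul, add_assoc]
  rw [hscale, hlq, hhomog l hl _ hrV, hhomog l hl q (hHV hq)] at hr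
  simpa using le_of_mul_le_mul_left hr (Real.rpow_pos_of_pos hl k)

end Cone

/-- For a Euclidean complete (closed) connected hyperbolic centroaffine
hypersurface `H` (a component of a level set of a smooth positively homogeneous
function of degree `k > 0` on an open cone `V`), the cone `U = ℝ^{>0}·H` is open and
convex, and `(λ, x) ↦ λ • x` is a homeomorphism from `(0,∞) × H` onto `U`. -/
theorem stmt_0 (n : ℕ) (hn : 1 ≤ n)
    (V : Set (EuclideanSpace ℝ (Fin (n + 1)))) (hVopen : IsOpen V)
    (hVcone : ∀ l : ℝ, 0 < l → ∀ x ∈ V, l • x ∈ V)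
    (k : ℝ) (hk : 0 < k)
    (h : EuclideanSpace ℝ (Fin (n + 1)) → ℝ)
    (hsmooth : ContDiffOn ℝ (⊤ : ℕ∞) h V)
    (hhomog : ∀ l : ℝ, 0 < l → ∀ x ∈ V, h (l • x) = l ^ k * h x)
    (H : Set (EuclideanSpace ℝ (Fin (n + 1))))
    (x₀ : EuclideanSpace ℝ (Fin (n + 1))) (hx₀V : x₀ ∈ V) (hx₀1 : h x₀ = 1)
    (hH : H = connectedComponentIn {x ∈ V | h x = 1} x₀)
    (hHclosed : IsClosed H)
    (hhyp : ∀ p ∈ H, ∀ v : EuclideanSpace ℝ (Fin (n + 1)),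
      fderiv ℝ h p v = 0 → v ≠ 0 → fderiv ℝ (fderiv ℝ h) p v v < 0) :
    IsOpen {y | ∃ l : ℝ, 0 < l ∧ ∃ x ∈ H, y = l • x} ∧
    Convex ℝ {y | ∃ l : ℝ, 0 < l ∧ ∃ x ∈ H, y = l • x} ∧
    ∃ φ : Ioi (0 : ℝ) × H ≃ₜ {y | ∃ l : ℝ, 0 < l ∧ ∃ x ∈ H, y = l • x},
      ∀ p : Ioi (0 : ℝ) × H,
        (φ p : EuclideanSpace ℝ (Fin (n + 1)))
          = (p.1 : ℝ) • (p.2 : EuclideanSpace ℝ (Fin (n + 1))) := by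
  have hcont : ContinuousOn h V := hsmooth.continuousOn
  have hHsub : H ⊆ {x ∈ V | h x = 1} := hH ▸ connectedComponentIn_subset _ _
  have hUeq : {y | ∃ l : ℝ, 0 < l ∧ ∃ x ∈ H, y = l • x} =
      connectedComponentIn {x ∈ V | 0 < h x} x₀ :=
    hH ▸ cone_connectedComponentIn_eq hVcone hcont hk hhomog ⟨hx₀V, hx₀1⟩
  have hUopen : IsOpen {y | ∃ l : ℝ, 0 < l ∧ ∃ x ∈ H, y = l • x} := by
    rw [hUeq]
    exact (hcont.isOpen_inter_preimage hVopen isOpen_Ioi).connectedComponentIn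
  have hUconn : IsPreconnected {y | ∃ l : ℝ, 0 < l ∧ ∃ x ∈ H, y = l • x} :=
    hUeq ▸ isPreconnected_connectedComponentIn
  have hUsub : {y | ∃ l : ℝ, 0 < l ∧ ∃ x ∈ H, y = l • x} ⊆ {x ∈ V | 0 < h x} :=
    hUeq ▸ connectedComponentIn_subset _ _
  have hzero : (0 : EuclideanSpace ℝ (Fin (n + 1))) ∉ H := fun h0 => by
    obtain ⟨h0V, h01⟩ := hHsub h0
    have h2 := hhomog 2 two_pos 0 h0V
    rw [smul_zero, h01, mul_one] at h2
    exact (Real.one_lt_rpow one_lt_two hk).ne h2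
  refine ⟨hUopen, ?_, exists_cone_homeomorph hVcone hcont hk hhomog hHsub⟩
  refine convex_of_segments_subset_closed (h := h)
    (K := fun c => {y | ∃ l : ℝ, c ^ k⁻¹ ≤ l ∧ ∃ x ∈ H, y = l • x}) hUopen hUconn
    (hcont.mono fun x hx => (hUsub hx).1) (fun x hx => (hUsub hx).2)
    (fun c hc => isClosed_truncated_cone hHclosed hzero (Real.rpow_pos_of_pos hc _)) ?_ ?_
  · rintro c hc _ ⟨l, hl, x, hx, rfl⟩
    exact ⟨l, (Real.rpow_pos_of_pos hc _).trans_le hl, x, hx, rfl⟩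
  · intro c hc x y hcx hcy hseg z hz
    have hcz : c ≤ h z := (le_min hcx hcy).trans
      (le_of_segment_subset_cone hVopen hVcone
        (hsmooth.of_le (WithTop.coe_le_coe.2 (le_top : (2 : ℕ∞) ≤ ⊤))) hhomog
        (fun p hp => (hHsub hp).1) hhyp hseg hz)
    obtain ⟨l, hl, q, hq, rfl⟩ := hseg hz
    refine ⟨l, ?_, q, hq, rfl⟩
    rw [hhomog l hl q (hHsub hq).1, (hHsub hq).2, mul_one] at hcz
    exact (Real.rpow_inv_le_iff_of_pos hc.le hl.le hk).2 hcz
end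

section
/- Let V ⊆ ℝ^{n+1} be an open cone, k > 0, and h : V → ℝ a smooth function positively homogeneous of degree k. Let H be a connected component of {x ∈ V : h(x) = 1} that is a closed subset of ℝ^{n+1}, with D²h_p negative definite on ker Dh_p for every p ∈ H, and set U := {λx : λ > 0, x ∈ H}. Then for every p ∈ H the intersection U ∩ (p + ker Dh_p) of U with the affine tangent hyperplane of H at p is a bounded subset of ℝ^{n+1}. -/
open Set

open Filter Topology

section Homogeneous

variable {E G : Type*} [NormedAddCommGroup E] [NormedSpace ℝ E]
  [NormedAddCommGroup G] [NormedSpace ℝ G]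

/-- The derivative of a positively homogeneous map of degree `m` is homogeneous of degree `m - 1`. -/
lemma fderiv_smul_of_homogeneous {F : E → G} {V : Set E} (hV : IsOpen V)
    (hVc : ∀ l : ℝ, 0 < l → ∀ x ∈ V, l • x ∈ V) {m : ℝ} (hd : DifferentiableOn ℝ F V)
    (hF : ∀ l : ℝ, 0 < l → ∀ x ∈ V, F (l • x) = l ^ m • F x)
    {l : ℝ} (hl : 0 < l) {x : E} (hx : x ∈ V) :
    fderiv ℝ F (l • x) = l ^ (m - 1) • fderiv ℝ F x := by
  have h1 : HasFDerivAt (fun y => F (l • y))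
      ((fderiv ℝ F (l • x)).comp (l • ContinuousLinearMap.id ℝ E)) x :=
    HasFDerivAt.comp x (hd.differentiableAt (hV.mem_nhds (hVc l hl x hx))).hasFDerivAt
      ((hasFDerivAt_id x).const_smul l)
  have h2 : HasFDerivAt (fun y => l ^ m • F y) (l ^ m • fderiv ℝ F x) x :=
    (hd.differentiableAt (hV.mem_nhds hx)).hasFDerivAt.const_smul _
  have h3 := h1.unique (h2.congr_of_eventuallyEq
    (by filter_upwards [hV.mem_nhds hx] with y hy using hF l hl y hy))
  ext v
  have h4 := congrArg (fun L => l⁻¹ • L v) h3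
  simp only [ContinuousLinearMap.comp_apply, smul_apply,
    ContinuousLinearMap.id_apply, map_smul, smul_smul, inv_mul_cancel₀ hl.ne', one_smul] at h4
  rw [h4, smul_apply, Real.rpow_sub_one hl.ne', div_eq_inv_mul]

/-- Euler's identity. -/
lemma fderiv_apply_self_of_homogeneous {F : E → G} {V : Set E} (hV : IsOpen V) {m : ℝ}
    (hd : DifferentiableOn ℝ F V)
    (hF : ∀ l : ℝ, 0 < l → ∀ x ∈ V, F (l • x) = l ^ m • F x) {x : E} (hx : x ∈ V) :
    fderiv ℝ F x x = m • F x := by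
  have h1 : HasDerivAt (fun l : ℝ => F (l • x)) (fderiv ℝ F x ((1 : ℝ) • x)) 1 := by
    refine HasFDerivAt.comp_hasDerivAt (f := fun l : ℝ => l • x) (1 : ℝ) ?_
      ((hasDerivAt_id (1 : ℝ)).smul_const x)
    rw [one_smul]
    exact (hd.differentiableAt (hV.mem_nhds hx)).hasFDerivAt
  have h2 : HasDerivAt (fun l : ℝ => l ^ m • F x) ((m * (1 : ℝ) ^ (m - 1)) • F x) 1 :=
    (Real.hasDerivAt_rpow_const (Or.inl one_ne_zero)).smul_const _
  have h3 := h1.unique (h2.congr_of_eventuallyEq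
    (by filter_upwards [lt_mem_nhds (zero_lt_one (α := ℝ))] with l hl using hF l hl x hx))
  simpa using h3

lemma hessian_le_sq_of_eq_one {h : E → ℝ} {V : Set E} (hV : IsOpen V)
    (hVc : ∀ l : ℝ, 0 < l → ∀ x ∈ V, l • x ∈ V) {k : ℝ} (hk : 0 < k)
    (hs : ContDiffOn ℝ (⊤ : ℕ∞) h V)
    (hh : ∀ l : ℝ, 0 < l → ∀ x ∈ V, h (l • x) = l ^ k * h x) {q : E} (hq : q ∈ V) (hq1 : h q = 1)
    (hneg : ∀ v, fderiv ℝ h q v = 0 → v ≠ 0 → fderiv ℝ (fderiv ℝ h) q v v < 0) (v : E) :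
    fderiv ℝ (fderiv ℝ h) q v v ≤ (fderiv ℝ h q v) ^ 2 := by
  have hd : DifferentiableOn ℝ h V := hs.differentiableOn (by simp)
  have hd2 : DifferentiableOn ℝ (fderiv ℝ h) V :=
    (hs.fderiv_of_isOpen (m := 1) hV (by norm_cast)).differentiableOn (by simp)
  have e1 : fderiv ℝ h q q = k := by
    simpa [hq1] using fderiv_apply_self_of_homogeneous hV hd hh hq
  have e2 : fderiv ℝ (fderiv ℝ h) q q = (k - 1) • fderiv ℝ h q :=
    fderiv_apply_self_of_homogeneous hV hd2
      (fun l hl x hx => fderiv_smul_of_homogeneous hV hVc hd hh hl hx) hq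
  have hsym : IsSymmSndFDerivAt ℝ h q :=
    (hs.contDiffAt (hV.mem_nhds hq)).isSymmSndFDerivAt
      (by simp only [minSmoothness_of_isRCLikeNormedField]; norm_cast)
  obtain ⟨a, w, hw, rfl⟩ : ∃ (a : ℝ) (w : E), fderiv ℝ h q w = 0 ∧ v = a • q + w := by
    refine ⟨fderiv ℝ h q v / k, v - (fderiv ℝ h q v / k) • q, ?_, by abel⟩
    simp [e1, hk.ne']
  have e3 : fderiv ℝ (fderiv ℝ h) q w q = 0 := by
    rw [hsym.eq w q, e2]; simp [hw]
  have e4 : fderiv ℝ (fderiv ℝ h) q w w ≤ 0 := by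
    rcases eq_or_ne w 0 with rfl | h0
    · simp
    · exact (hneg w hw h0).le
  simp only [map_add, map_smul, add_apply, smul_apply,
    e1, e2, e3, hw, smul_eq_mul]
  nlinarith [mul_nonneg hk.le (sq_nonneg a)]

lemma hessian_mul_le_sq_of_homogeneous {h : E → ℝ} {V : Set E} (hV : IsOpen V)
    (hVc : ∀ l : ℝ, 0 < l → ∀ x ∈ V, l • x ∈ V) {k : ℝ} (hk : 0 < k)
    (hs : ContDiffOn ℝ (⊤ : ℕ∞) h V)
    (hh : ∀ l : ℝ, 0 < l → ∀ x ∈ V, h (l • x) = l ^ k * h x) {q : E} (hq : q ∈ V) (hq1 : h q = 1)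
    (hneg : ∀ v, fderiv ℝ h q v = 0 → v ≠ 0 → fderiv ℝ (fderiv ℝ h) q v v < 0)
    {l : ℝ} (hl : 0 < l) (v : E) :
    fderiv ℝ (fderiv ℝ h) (l • q) v v * h (l • q) ≤ (fderiv ℝ h (l • q) v) ^ 2 := by
  have hd : DifferentiableOn ℝ h V := hs.differentiableOn (by simp)
  have hd2 : DifferentiableOn ℝ (fderiv ℝ h) V :=
    (hs.fderiv_of_isOpen (m := 1) hV (by norm_cast)).differentiableOn (by simp)
  have hh1 : ∀ l : ℝ, 0 < l → ∀ x ∈ V, fderiv ℝ h (l • x) = l ^ (k - 1) • fderiv ℝ h x :=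
    fun l hl x hx => fderiv_smul_of_homogeneous hV hVc hd hh hl hx
  have hbase := hessian_le_sq_of_eq_one hV hVc hk hs hh hq hq1 hneg v
  rw [fderiv_smul_of_homogeneous hV hVc hd2 hh1 hl hq, hh1 l hl q hq, hh l hl q hq, hq1]
  simp only [smul_apply, smul_eq_mul, mul_one, mul_pow]
  have e : l ^ (k - 1 - 1) * l ^ k = (l ^ (k - 1)) ^ 2 := by
    rw [← Real.rpow_add hl, sq, ← Real.rpow_add hl]; ring_nf
  calc l ^ (k - 1 - 1) * fderiv ℝ (fderiv ℝ h) q v v * l ^ k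
      = (l ^ (k - 1)) ^ 2 * fderiv ℝ (fderiv ℝ h) q v v := by rw [← e]; ring
    _ ≤ _ := by gcongr

end Homogeneous

section LogConcave

variable {E : Type*} [NormedAddCommGroup E] [NormedSpace ℝ E]

lemma hasDerivAt_comp_add_smul {G : Type*} [NormedAddCommGroup G] [NormedSpace ℝ G]
    {F : E → G} {x v : E} {t : ℝ} (hF : DifferentiableAt ℝ F (x + t • v)) :
    HasDerivAt (fun s : ℝ => F (x + s • v)) (fderiv ℝ F (x + t • v) v) t := by
  have h1 : HasDerivAt (fun s : ℝ => x + s • v) v t := by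
    simpa using ((hasDerivAt_id t).smul_const v).const_add x
  exact hF.hasFDerivAt.comp_hasDerivAt t h1

lemma concaveOn_log_comp_line {h : E → ℝ} {U : Set E} (hU : IsOpen U)
    (hs : ContDiffOn ℝ 2 h U) (hpos : ∀ y ∈ U, 0 < h y)
    (hhess : ∀ y ∈ U, ∀ v, fderiv ℝ (fderiv ℝ h) y v v * h y ≤ (fderiv ℝ h y v) ^ 2)
    {D : Set ℝ} (hD : Convex ℝ D) {x v : E} (hDU : ∀ t ∈ D, x + t • v ∈ U) :
    ConcaveOn ℝ D (fun t => Real.log (h (x + t • v))) := by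
  have hd : ∀ y ∈ U, DifferentiableAt ℝ h y := fun y hy =>
    (hs.differentiableOn (by simp)).differentiableAt (hU.mem_nhds hy)
  have hd2 : ∀ y ∈ U, DifferentiableAt ℝ (fderiv ℝ h) y := fun y hy =>
    ((hs.fderiv_of_isOpen (m := 1) hU (by norm_num)).differentiableOn
      (by simp)).differentiableAt (hU.mem_nhds hy)
  have d1 : ∀ t ∈ D, HasDerivAt (fun t => h (x + t • v)) (fderiv ℝ h (x + t • v) v) t :=
    fun t ht => hasDerivAt_comp_add_smul (hd _ (hDU t ht))
  have d2 : ∀ t ∈ D, HasDerivAt (fun t => fderiv ℝ h (x + t • v) v)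
      (fderiv ℝ (fderiv ℝ h) (x + t • v) v v) t := fun t ht => by
    simpa using (hasDerivAt_comp_add_smul (hd2 _ (hDU t ht))).clm_apply (hasDerivAt_const t v)
  have dlog : ∀ t ∈ D, HasDerivAt (fun t => Real.log (h (x + t • v)))
      (fderiv ℝ h (x + t • v) v / h (x + t • v)) t := fun t ht =>
    (d1 t ht).log (hpos _ (hDU t ht)).ne'
  refine concaveOn_of_hasDerivWithinAt2_nonpos hD
    (fun t ht => (dlog t ht).continuousAt.continuousWithinAt)
    (fun t ht => (dlog t (interior_subset ht)).hasDerivWithinAt)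
    (fun t ht => ((d2 t (interior_subset ht)).div (d1 t (interior_subset ht))
      (hpos _ (hDU t (interior_subset ht))).ne').hasDerivWithinAt) ?_
  intro t ht
  have := hhess _ (hDU t (interior_subset ht)) v
  refine div_nonpos_of_nonpos_of_nonneg ?_ (sq_nonneg _)
  nlinarith

/-- A positive function whose logarithm is concave along segments is bounded below on a segment
by its values at the ends. -/
lemma le_of_concaveOn_log_segment {h : E → ℝ} {x v : E} {c : ℝ} (hc : 0 < c)
    (hpos : ∀ t ∈ Icc (0 : ℝ) 1, 0 < h (x + t • v))
    (hcc : ConcaveOn ℝ (Icc (0 : ℝ) 1) (fun t : ℝ => Real.log (h (x + t • v))))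
    (h0 : c ≤ h x) (h1 : c ≤ h (x + v)) {t : ℝ} (ht : t ∈ Icc (0 : ℝ) 1) :
    c ≤ h (x + t • v) := by
  have := hcc.min_le_of_mem_Icc (left_mem_Icc.2 zero_le_one) (right_mem_Icc.2 zero_le_one) ht
  simp only [zero_smul, add_zero, one_smul] at this
  refine (Real.log_le_log_iff hc (hpos t ht)).1 (le_trans ?_ this)
  exact le_min (Real.log_le_log hc h0) (Real.log_le_log hc h1)

/-- A local-to-global principle for convexity of the domain of a log-concave function all of whose
positive superlevel sets are closed. -/
lemma segment_mem_of_log_concave {h : E → ℝ} {U : Set E} (hU : IsOpen U) (hconn : IsPreconnected U)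
    (hs : ContDiffOn ℝ 2 h U) (hpos : ∀ y ∈ U, 0 < h y)
    (hhess : ∀ y ∈ U, ∀ v, fderiv ℝ (fderiv ℝ h) y v v * h y ≤ (fderiv ℝ h y v) ^ 2)
    (hcl : ∀ c : ℝ, 0 < c → IsClosed {z | z ∈ U ∧ c ≤ h z})
    {p : E} (hp : p ∈ U) {q : E} (hq : q ∈ U) :
    ∀ t ∈ Icc (0 : ℝ) 1, p + t • (q - p) ∈ U := by
  let W : Set E := {q | ∀ t ∈ Icc (0 : ℝ) 1, p + t • (q - p) ∈ U}
  have hWU : W ⊆ U := fun q hq => by simpa using hq 1 (by simp)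
  have hWo : IsOpen W := by
    rw [isOpen_iff_mem_nhds]
    intro q hq
    refine isCompact_Icc.eventually_forall_of_forall_eventually
      (P := fun q (t : ℝ) => p + t • (q - p) ∈ U) fun t ht => ?_
    have hcont : Continuous fun z : E × ℝ => p + z.2 • (z.1 - p) := by fun_prop
    exact hcont.continuousAt.eventually (hU.mem_nhds (hq t ht))
  have hsub : U ⊆ W := by
    refine hconn.subset_of_closure_inter_subset hWo ⟨p, hp, fun t _ => by simpa using hp⟩ ?_
    rintro q ⟨hqW, hqU⟩ t ht
    have hq0 := hpos q hqU
    set c := min (h p) (h q / 2) with hc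
    have hc0 : 0 < c := lt_min (hpos p hp) (by positivity)
    have hev : ∀ᶠ z in 𝓝 q, h q / 2 < h z :=
      (hs.continuousOn.continuousAt (hU.mem_nhds hqU)).eventually (lt_mem_nhds (by linarith))
    have hfreq : ∃ᶠ z in 𝓝 q, p + t • (z - p) ∈ {z | z ∈ U ∧ c ≤ h z} := by
      refine ((mem_closure_iff_frequently.1 hqW).and_eventually hev).mono ?_
      rintro z ⟨hz, hzq⟩
      refine ⟨hz t ht, le_of_concaveOn_log_segment hc0 (fun t ht => hpos _ (hz t ht))
        (concaveOn_log_comp_line hU hs hpos hhess (convex_Icc 0 1) hz) (min_le_left _ _) ?_ ht⟩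
      rw [add_sub_cancel]
      exact (min_le_right _ _).trans hzq.le
    have hcont : Continuous fun z : E => p + t • (z - p) := by fun_prop
    exact ((hcl c hc0).mem_of_frequently_of_tendsto hfreq hcont.continuousAt).1
  exact hsub hq

end LogConcave

section Cone

variable {E : Type*} [NormedAddCommGroup E] [NormedSpace ℝ E]

/-- The cone over a connected component of a level set is a connected component of the
positivity set. -/
lemma cone_eq_connectedComponentIn {h : E → ℝ} {V : Set E}
    (hVc : ∀ l : ℝ, 0 < l → ∀ x ∈ V, l • x ∈ V) {k : ℝ} (hk : 0 < k) (hcont : ContinuousOn h V)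
    (hh : ∀ l : ℝ, 0 < l → ∀ x ∈ V, h (l • x) = l ^ k * h x) {x₀ : E} (hx₀ : x₀ ∈ V)
    (hx₁ : h x₀ = 1) :
    {y | ∃ l : ℝ, 0 < l ∧ ∃ x ∈ connectedComponentIn {x ∈ V | h x = 1} x₀, y = l • x} =
      connectedComponentIn {x ∈ V | 0 < h x} x₀ := by
  have hx₀L : x₀ ∈ {x ∈ V | h x = 1} := ⟨hx₀, hx₁⟩
  have hx₀P : x₀ ∈ {x ∈ V | 0 < h x} := ⟨hx₀, by simp [hx₁]⟩
  apply Subset.antisymm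
  · refine IsPreconnected.subset_connectedComponentIn ?_
      ⟨1, one_pos, x₀, mem_connectedComponentIn hx₀L, by simp⟩ ?_
    · have : IsPreconnected ((fun z : ℝ × E => z.1 • z.2) ''
          (Ioi (0 : ℝ) ×ˢ connectedComponentIn {x ∈ V | h x = 1} x₀)) :=
        (isPreconnected_Ioi.prod isPreconnected_connectedComponentIn).image _
          (by fun_prop)
      convert this using 1
      ext y
      constructor
      · rintro ⟨l, hl, x, hx, rfl⟩
        exact ⟨(l, x), ⟨hl, hx⟩, rfl⟩
      · rintro ⟨⟨l, x⟩, ⟨hl, hx⟩, rfl⟩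
        exact ⟨l, hl, x, hx, rfl⟩
    · rintro y ⟨l, hl, x, hx, rfl⟩
      obtain ⟨hxV, hx1⟩ := connectedComponentIn_subset _ _ hx
      refine ⟨hVc l hl x hxV, ?_⟩
      rw [hh l hl x hxV, hx1]
      positivity
  · set C := connectedComponentIn {x ∈ V | 0 < h x} x₀ with hC
    have hCsub : C ⊆ {x ∈ V | 0 < h x} := connectedComponentIn_subset _ _
    let r : E → E := fun x => (h x ^ (-k⁻¹)) • x
    have hr : (r '' C) ⊆ connectedComponentIn {x ∈ V | h x = 1} x₀ := by
      refine IsPreconnected.subset_connectedComponentIn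
        (isPreconnected_connectedComponentIn.image r ?_)
        ⟨x₀, mem_connectedComponentIn hx₀P, by simp [r, hx₁]⟩ ?_
      · refine ContinuousOn.smul (ContinuousOn.rpow_const
          (hcont.mono fun x hx => (hCsub hx).1) fun x hx => Or.inl (hCsub hx).2.ne')
          continuousOn_id
      · rintro _ ⟨x, hx, rfl⟩
        obtain ⟨hxV, hx0⟩ := hCsub hx
        have hl : 0 < h x ^ (-k⁻¹) := by positivity
        refine ⟨hVc _ hl x hxV, ?_⟩
        rw [hh _ hl x hxV, ← Real.rpow_mul hx0.le]
        simp [hk.ne', Real.rpow_neg hx0.le, hx0.ne']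
    intro x hx
    have hx0 := (hCsub hx).2
    have hl : 0 < h x ^ (-k⁻¹) := by positivity
    exact ⟨(h x ^ (-k⁻¹))⁻¹, by positivity, r x, hr ⟨x, hx, rfl⟩, by
      simp only [r, smul_smul, inv_mul_cancel₀ hl.ne', one_smul]⟩

lemma isClosed_superlevel_cone {h : E → ℝ} {V : Set E}
    {k : ℝ} (hk : 0 < k)
    (hh : ∀ l : ℝ, 0 < l → ∀ x ∈ V, h (l • x) = l ^ k * h x) {H : Set E}
    (hHV : ∀ x ∈ H, x ∈ V ∧ h x = 1) (h0 : (0 : E) ∉ H) (hcl : IsClosed H) {c : ℝ} (hc : 0 < c) :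
    IsClosed {z | z ∈ {y | ∃ l : ℝ, 0 < l ∧ ∃ x ∈ H, y = l • x} ∧ c ≤ h z} := by
  set C : ℝ := c ^ (-k⁻¹) with hC
  have hC0 : 0 < C := by positivity
  have hCk : C ^ k = c⁻¹ := by
    rw [hC, ← Real.rpow_mul hc.le]; simp [hk.ne', Real.rpow_neg hc.le]
  have hA : IsClosed {z : Icc 0 C × E | (z.1 : ℝ) • z.2 ∈ H} :=
    hcl.preimage (by fun_prop)
  convert isClosedMap_snd_of_compactSpace _ hA using 1
  ext z
  constructor
  · rintro ⟨⟨l, hl, x, hx, rfl⟩, hz⟩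
    obtain ⟨hxV, hx1⟩ := hHV x hx
    rw [hh l hl x hxV, hx1, mul_one] at hz
    refine ⟨(⟨l⁻¹, by positivity, ?_⟩, l • x), ?_, rfl⟩
    · rw [← Real.rpow_le_rpow_iff (by positivity) hC0.le hk, hCk, Real.inv_rpow hl.le]
      gcongr
    · simpa [smul_smul, hl.ne'] using hx
  · rintro ⟨⟨⟨s, hs0, hsC⟩, z⟩, hz, rfl⟩
    simp only [mem_ofPred_eq] at hz
    have hs : 0 < s := hs0.lt_of_ne (by rintro rfl; exact h0 (by simpa using hz))
    have hzs : z = s⁻¹ • (s • z) := by simp [smul_smul, hs.ne']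
    obtain ⟨hxV, hx1⟩ := hHV _ hz
    refine ⟨⟨s⁻¹, by positivity, s • z, hz, hzs⟩, ?_⟩
    change c ≤ h z
    rw [hzs, hh _ (by positivity) _ hxV, hx1, mul_one, Real.inv_rpow hs.le]
    rw [le_inv_comm₀ hc (by positivity), ← hCk]
    gcongr

end Cone

/-- Strict form of the second derivative test, to the right of a critical point. -/
lemma exists_pos_lt_of_deriv_deriv_neg {f f' : ℝ → ℝ} {f'' : ℝ}
    (hf : ∀ᶠ t in 𝓝 0, HasDerivAt f (f' t) t) (hf' : HasDerivAt f' f'' 0) (h0 : f' 0 = 0)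
    (hneg : f'' < 0) : ∃ t, 0 < t ∧ f t < f 0 := by
  have hsign := eventually_nhdsWithin_sign_eq_of_deriv_neg (by rwa [hf'.deriv]) h0
  obtain ⟨ε, hε, hball⟩ := Metric.eventually_nhds_iff.1 (hf.and hsign)
  have hmem : ∀ t ∈ Icc 0 (ε / 2), dist t 0 < ε := by
    intro t ht
    rw [Real.dist_eq, sub_zero, abs_of_nonneg ht.1]
    linarith [ht.2]
  have hanti : StrictAntiOn f (Icc 0 (ε / 2)) := by
    refine strictAntiOn_of_deriv_neg (convex_Icc _ _)
      (fun t ht => (hball (hmem t ht)).1.continuousAt.continuousWithinAt) fun t ht => ?_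
    rw [interior_Icc] at ht
    obtain ⟨hd, hsg⟩ := hball (hmem t (Ioo_subset_Icc_self ht))
    rw [hd.deriv]
    rw [zero_sub, sign_neg (neg_neg_of_pos ht.1)] at hsg
    exact sign_eq_neg_one_iff.1 hsg
  exact ⟨ε / 2, by positivity, hanti (by simp; positivity) (by simp; positivity) (by positivity)⟩

/-- Under the same hypotheses as Statement 0, the intersection of the
cone `U = ℝ^{>0}·H` with the affine tangent hyperplane `p + ker Dh_p` of `H` at any
`p ∈ H` is a bounded subset of `ℝ^{n+1}`. -/
theorem stmt_1 (n : ℕ)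
    (V : Set (EuclideanSpace ℝ (Fin (n + 1)))) (hVopen : IsOpen V)
    (hVcone : ∀ l : ℝ, 0 < l → ∀ x ∈ V, l • x ∈ V)
    (k : ℝ) (hk : 0 < k)
    (h : EuclideanSpace ℝ (Fin (n + 1)) → ℝ)
    (hsmooth : ContDiffOn ℝ (⊤ : ℕ∞) h V)
    (hhomog : ∀ l : ℝ, 0 < l → ∀ x ∈ V, h (l • x) = l ^ k * h x)
    (H : Set (EuclideanSpace ℝ (Fin (n + 1))))
    (x₀ : EuclideanSpace ℝ (Fin (n + 1))) (hx₀V : x₀ ∈ V) (hx₀1 : h x₀ = 1)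
    (hH : H = connectedComponentIn {x ∈ V | h x = 1} x₀)
    (hHclosed : IsClosed H)
    (hhyp : ∀ p ∈ H, ∀ v : EuclideanSpace ℝ (Fin (n + 1)),
      fderiv ℝ h p v = 0 → v ≠ 0 → fderiv ℝ (fderiv ℝ h) p v v < 0)
    (U : Set (EuclideanSpace ℝ (Fin (n + 1))))
    (hU : U = {y | ∃ l : ℝ, 0 < l ∧ ∃ x ∈ H, y = l • x}) :
    ∀ p ∈ H, Bornology.IsBounded (U ∩ {x | fderiv ℝ h p (x - p) = 0}) := by
  have hHV : ∀ x ∈ H, x ∈ V ∧ h x = 1 := fun x hx => by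
    exact connectedComponentIn_subset {x ∈ V | h x = 1} x₀ (hH ▸ hx)
  have h0 : (0 : EuclideanSpace ℝ (Fin (n + 1))) ∉ H := fun hm => by
    obtain ⟨hV0, h1⟩ := hHV 0 hm
    have := hhomog 2 two_pos 0 hV0
    rw [smul_zero, h1, mul_one] at this
    exact (Real.one_lt_rpow one_lt_two hk).ne this
  have hUC : U = connectedComponentIn {x ∈ V | 0 < h x} x₀ := by
    rw [hU, hH]
    exact cone_eq_connectedComponentIn hVcone hk hsmooth.continuousOn hhomog hx₀V hx₀1
  have hUP : U ⊆ {x ∈ V | 0 < h x} := hUC ▸ connectedComponentIn_subset _ _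
  have hUo : IsOpen U := by
    rw [hUC]
    exact (hsmooth.continuousOn.isOpen_inter_preimage hVopen isOpen_Ioi).connectedComponentIn
  have hUconn : IsPreconnected U := hUC ▸ isPreconnected_connectedComponentIn
  have hpos : ∀ y ∈ U, 0 < h y := fun y hy => (hUP hy).2
  have hs : ContDiffOn ℝ 2 h U :=
    (hsmooth.mono fun y hy => (hUP hy).1).of_le (by norm_cast)
  have hhess : ∀ y ∈ U, ∀ v, fderiv ℝ (fderiv ℝ h) y v v * h y ≤ (fderiv ℝ h y v) ^ 2 := by
    intro y hy v
    rw [hU] at hy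
    obtain ⟨l, hl, q, hq, rfl⟩ := hy
    exact hessian_mul_le_sq_of_homogeneous hVopen hVcone hk hsmooth hhomog (hHV q hq).1
      (hHV q hq).2 (hhyp q hq) hl v
  have hcl : ∀ c : ℝ, 0 < c → IsClosed {z | z ∈ U ∧ c ≤ h z} := fun c hc => by
    rw [hU]
    exact isClosed_superlevel_cone hk hhomog hHV h0 hHclosed hc
  have hHU : H ⊆ U := fun x hx => by rw [hU]; exact ⟨1, one_pos, x, hx, by simp⟩
  have hseg : ∀ {p q}, p ∈ U → q ∈ U → ∀ t ∈ Icc (0 : ℝ) 1, p + t • (q - p) ∈ U :=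
    fun hp hq => segment_mem_of_log_concave hUo hUconn hs hpos hhess hcl hp hq
  have hconc : ∀ {p q}, p ∈ U → q ∈ U →
      ConcaveOn ℝ (Icc 0 1) (fun t : ℝ => Real.log (h (p + t • (q - p)))) := fun hp hq =>
    concaveOn_log_comp_line hUo hs hpos hhess (convex_Icc 0 1) (hseg hp hq)
  have hd : ∀ y ∈ U, DifferentiableAt ℝ h y := fun y hy =>
    (hs.differentiableOn (by simp)).differentiableAt (hUo.mem_nhds hy)
  have hd2 : ∀ y ∈ U, DifferentiableAt ℝ (fderiv ℝ h) y := fun y hy =>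
    ((hs.fderiv_of_isOpen (m := 1) hUo (by norm_num)).differentiableOn
      (by simp)).differentiableAt (hUo.mem_nhds hy)
  intro p hp
  have hpU := hHU hp
  have hp1 := (hHV p hp).2
  -- On the tangent hyperplane, `h ≤ 1`.
  have hle : ∀ y ∈ U, fderiv ℝ h p (y - p) = 0 → h y ≤ 1 := by
    intro y hy hy0
    have hder : HasDerivAt (fun t : ℝ => Real.log (h (p + t • (y - p)))) 0 0 := by
      have := (hasDerivAt_comp_add_smul (F := h) (x := p) (v := y - p) (t := 0)
        (by simpa using hd p hpU)).log (by simp [hp1])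
      simpa [hy0] using this
    have := (hconc hpU hy).slope_le_of_hasDerivAt (x := 0) (y := 1) (by simp) (by simp)
      one_pos hder
    simp only [slope, sub_zero, inv_one, one_smul, add_sub_cancel, zero_smul, add_zero, hp1,
      Real.log_one, vsub_eq_sub] at this
    exact (Real.log_nonpos_iff (hpos y hy).le).1 this
  by_contra hunb
  -- An unbounded sequence in the intersection yields a ray from `p` on which `h ≥ 1`.
  have hseq : ∀ j : ℕ, ∃ y ∈ U ∩ {x | fderiv ℝ h p (x - p) = 0}, (j : ℝ) < ‖y‖ := by
    intro j
    by_contra! hj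
    exact hunb (isBounded_iff_forall_norm_le.2 ⟨j, hj⟩)
  choose y hy hyn using hseq
  have hy0 : ∀ j, 0 < ‖y j‖ := fun j => (Nat.cast_nonneg j).trans_lt (hyn j)
  have hytop : Tendsto (fun j => ‖y j‖) atTop atTop :=
    tendsto_atTop_mono (fun j => (hyn j).le) tendsto_natCast_atTop_atTop
  obtain ⟨v, hv, φ, hφ, hlim⟩ :=
    (isCompact_sphere (0 : EuclideanSpace ℝ (Fin (n + 1))) 1).tendsto_subseq
      (x := fun j => ‖y j‖⁻¹ • y j) (fun j => by simp [norm_smul, (hy0 j).ne'])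
  have hinv : Tendsto (fun j => ‖y (φ j)‖⁻¹) atTop (𝓝 0) :=
    tendsto_inv_atTop_zero.comp (hytop.comp hφ.tendsto_atTop)
  have hv0 : v ≠ 0 := by rintro rfl; simp at hv
  have hvker : fderiv ℝ h p v = 0 := by
    have l1 := ((fderiv ℝ h p).continuous.tendsto v).comp hlim
    have l2 : Tendsto (fun j => ‖y (φ j)‖⁻¹ * fderiv ℝ h p p) atTop (𝓝 0) := by
      simpa using hinv.mul_const (fderiv ℝ h p p)
    refine tendsto_nhds_unique (l1.congr fun j => ?_) l2
    have := (hy (φ j)).2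
    simp only [mem_ofPred_eq, map_sub, sub_eq_zero] at this
    simp [this]
  have hray : ∀ t : ℝ, 0 ≤ t → p + t • v ∈ {z | z ∈ U ∧ 1 ≤ h z} := by
    intro t ht
    have hU1 : ∀ j, ∃ s : ℝ, 1 ≤ s ∧ s • y j ∈ H := by
      intro j
      obtain ⟨hyU, hyE⟩ := hy j
      have h1 := hle _ hyU hyE
      rw [hU] at hyU
      obtain ⟨l, hl, x, hx, hyx⟩ := hyU
      rw [hyx, hhomog l hl x (hHV x hx).1, (hHV x hx).2, mul_one] at h1
      refine ⟨l⁻¹, (one_le_inv₀ hl).2 ?_, by simpa [hyx, smul_smul, hl.ne'] using hx⟩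
      by_contra! hl1
      exact (Real.one_lt_rpow hl1 hk).not_ge h1
    choose s hs1 hsH using hU1
    have hτ : Tendsto (fun j => t * ((s (φ j))⁻¹ * ‖y (φ j)‖⁻¹)) atTop (𝓝 0) := by
      have : Tendsto (fun j => (s (φ j))⁻¹ * ‖y (φ j)‖⁻¹) atTop (𝓝 0) := by
        refine squeeze_zero (fun j => ?_) (fun j => ?_) hinv
        · have := hs1 (φ j); positivity
        · exact mul_le_of_le_one_left (by positivity) (inv_le_one_of_one_le₀ (hs1 _))
      simpa using this.const_mul t
    have hz : Tendsto (fun j => p + (t * ((s (φ j))⁻¹ * ‖y (φ j)‖⁻¹)) • (s (φ j) • y (φ j) - p))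
        atTop (𝓝 (p + t • v)) := by
      have l1 : Tendsto (fun j => p + (t • (‖y (φ j)‖⁻¹ • y (φ j)) -
          (t * ((s (φ j))⁻¹ * ‖y (φ j)‖⁻¹)) • p)) atTop (𝓝 (p + (t • v - (0 : ℝ) • p))) :=
        ((hlim.const_smul t).sub (hτ.smul_const p)).const_add p
      rw [zero_smul, sub_zero] at l1
      refine l1.congr fun j => ?_
      have hsne : s (φ j) ≠ 0 := by linarith [hs1 (φ j)]
      rw [smul_sub, smul_smul, smul_smul]
      congr 3
      field_simp
    refine (hcl 1 one_pos).mem_of_tendsto hz ?_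
    filter_upwards [hτ.eventually (gt_mem_nhds one_pos)] with j hj
    have hs0 : 0 < s (φ j) := by linarith [hs1 (φ j)]
    have hmem : t * ((s (φ j))⁻¹ * ‖y (φ j)‖⁻¹) ∈ Icc (0 : ℝ) 1 := ⟨by positivity, hj.le⟩
    have hqU := hHU (hsH (φ j))
    refine ⟨hseg hpU hqU _ hmem, le_of_concaveOn_log_segment one_pos
      (fun t ht => hpos _ (hseg hpU hqU t ht)) (hconc hpU hqU) hp1.ge ?_ hmem⟩
    rw [add_sub_cancel, (hHV _ (hsH (φ j))).2]
  have hpv : p + (0 : ℝ) • v ∈ U := by simpa using hpU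
  have hnear : ∀ᶠ t : ℝ in 𝓝 0, p + t • v ∈ U := by
    have hc : Continuous fun t : ℝ => p + t • v := by fun_prop
    exact hc.continuousAt.eventually (hUo.mem_nhds hpv)
  obtain ⟨t, ht, hlt⟩ := exists_pos_lt_of_deriv_deriv_neg (f := fun t : ℝ => h (p + t • v))
    (f' := fun t => fderiv ℝ h (p + t • v) v)
    (hnear.mono fun t ht => hasDerivAt_comp_add_smul (hd _ ht))
    ((hasDerivAt_comp_add_smul (hd2 _ hpv)).clm_apply (hasDerivAt_const 0 v))
    (by simpa using hvker) (by simpa using hhyp p hp v hvker hv0)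
  simp only [zero_smul, add_zero, hp1] at hlt
  exact hlt.not_ge (hray t ht.le).2
end

section
/- Let E be a finite-dimensional real inner product space, B ⊆ E an open convex set, and u : B → ℝ a smooth concave function with u(x) > 0 for all x ∈ B. Let p ∈ B with u(p) = 1 and Du_p = 0, and suppose there exist δ > 0 and ε > 0 such that the closed ball of radius δ around p is contained in B and D²u_x(w, w) ≤ −ε·|w|² for all x in that ball and all w ∈ E. Then B is a bounded subset of E. -/
open Set

/-- If `u` is twice continuously differentiable along the segment from `p` to `p + w`, with
`Du_p = 0` and `D²u (w, w) ≤ -c` on the segment, then `u (p + w) ≤ u p - c / 2`. -/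
theorem le_sub_half_of_hessian_le {E : Type*} [NormedAddCommGroup E] [NormedSpace ℝ E]
    {u : E → ℝ} {p w : E} {c : ℝ}
    (hu : ∀ t ∈ Icc (0 : ℝ) 1, ContDiffAt ℝ 2 u (p + t • w)) (hdu : fderiv ℝ u p = 0)
    (hhess : ∀ t ∈ Icc (0 : ℝ) 1, fderiv ℝ (fderiv ℝ u) (p + t • w) w w ≤ -c) :
    u (p + w) ≤ u p - c / 2 := by
  have hline (t : ℝ) : HasDerivAt (fun t : ℝ ↦ p + t • w) w t := by
    simpa using ((hasDerivAt_id t).smul_const w).const_add p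
  have hderiv : ∀ t ∈ Icc (0 : ℝ) 1,
      HasDerivAt (fun t ↦ u (p + t • w) + c / 2 * t ^ 2)
        (fderiv ℝ u (p + t • w) w + c * t) t := by
    intro t ht
    have h := ((hu t ht).differentiableAt (by norm_num)).hasFDerivAt.comp_hasDerivAt t (hline t)
    refine (h.add (((hasDerivAt_id t).pow 2).const_mul (c / 2))).congr_deriv ?_
    simp
    ring
  have hderiv' : ∀ t ∈ Icc (0 : ℝ) 1,
      HasDerivAt (fun t ↦ fderiv ℝ u (p + t • w) w + c * t)
        (fderiv ℝ (fderiv ℝ u) (p + t • w) w w + c) t := by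
    intro t ht
    have hd : DifferentiableAt ℝ (fderiv ℝ u) (p + t • w) :=
      ((hu t ht).fderiv_right (m := 1) (by norm_num)).differentiableAt (by norm_num)
    have h : HasDerivAt (fun t : ℝ ↦ fderiv ℝ u (p + t • w))
        (fderiv ℝ (fderiv ℝ u) (p + t • w) w) t :=
      hd.hasFDerivAt.comp_hasDerivAt t (hline t)
    have happly : HasDerivAt (fun t : ℝ ↦ fderiv ℝ u (p + t • w) w)
        (fderiv ℝ (fderiv ℝ u) (p + t • w) w w) t :=
      (ContinuousLinearMap.apply ℝ ℝ w).hasFDerivAt.comp_hasDerivAt t h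
    exact (happly.add ((hasDerivAt_id t).const_mul c)).congr_deriv (by rw [mul_one])
  have hanti' : AntitoneOn (fun t ↦ fderiv ℝ u (p + t • w) w + c * t) (Icc (0 : ℝ) 1) := by
    refine antitoneOn_of_hasDerivWithinAt_nonpos (convex_Icc 0 1)
      (fun t ht ↦ (hderiv' t ht).continuousAt.continuousWithinAt)
      (fun t ht ↦ (hderiv' t (interior_subset ht)).hasDerivWithinAt) (fun t ht ↦ ?_)
    linarith [hhess t (interior_subset ht)]
  have hanti : AntitoneOn (fun t ↦ u (p + t • w) + c / 2 * t ^ 2) (Icc (0 : ℝ) 1) := by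
    refine antitoneOn_of_hasDerivWithinAt_nonpos (convex_Icc 0 1)
      (fun t ht ↦ (hderiv t ht).continuousAt.continuousWithinAt)
      (fun t ht ↦ (hderiv t (interior_subset ht)).hasDerivWithinAt) (fun t ht ↦ ?_)
    have ht' := interior_subset ht
    simpa [hdu] using hanti' (left_mem_Icc.2 zero_le_one) ht' ht'.1
  have h := hanti (left_mem_Icc.2 zero_le_one) (right_mem_Icc.2 zero_le_one) zero_le_one
  norm_num at h
  linarith

/-- A positive smooth concave function `u` on an open convex set `B`
in a finite-dimensional real inner product space, with `u(p) = 1`, `Du_p = 0` and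
Hessian `≤ -ε·|·|²` on a closed ball around `p` contained in `B`, forces `B`
to be bounded. -/
theorem stmt_2 (E : Type*) [NormedAddCommGroup E] [InnerProductSpace ℝ E]
    [FiniteDimensional ℝ E]
    (B : Set E) (hBopen : IsOpen B) (hBconv : Convex ℝ B)
    (u : E → ℝ) (hsmooth : ContDiffOn ℝ (⊤ : ℕ∞) u B)
    (hconc : ConcaveOn ℝ B u)
    (hpos : ∀ x ∈ B, 0 < u x)
    (p : E) (hp : p ∈ B) (hup : u p = 1) (hdu : fderiv ℝ u p = 0)
    (δ ε : ℝ) (hδ : 0 < δ) (hε : 0 < ε)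
    (hball : Metric.closedBall p δ ⊆ B)
    (hhess : ∀ x ∈ Metric.closedBall p δ, ∀ w : E,
      fderiv ℝ (fderiv ℝ u) x w w ≤ -ε * ‖w‖ ^ 2) :
    Bornology.IsBounded B := by
  refine Metric.isBounded_closedBall.subset (s := B) (t := Metric.closedBall p
    (max δ (2 / (ε * δ)))) fun x hx ↦ ?_
  rw [Metric.mem_closedBall, dist_eq_norm]
  by_contra! hlt
  obtain ⟨hδx, hx'⟩ := max_lt_iff.1 hlt
  have hr : 0 < ‖x - p‖ := hδ.trans hδx
  set s := δ / ‖x - p‖ with hs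
  have hs0 : 0 < s := div_pos hδ hr
  have hs1 : s ≤ 1 := (div_le_one hr).2 hδx.le
  have hw : ‖s • (x - p)‖ = δ := by
    rw [norm_smul, Real.norm_of_nonneg hs0.le, hs, div_mul_cancel₀ _ hr.ne']
  have hmem : ∀ t ∈ Icc (0 : ℝ) 1, p + t • s • (x - p) ∈ Metric.closedBall p δ := by
    intro t ht
    rw [Metric.mem_closedBall, dist_eq_norm, add_sub_cancel_left, norm_smul, hw,
      Real.norm_of_nonneg ht.1]
    exact mul_le_of_le_one_left hδ.le ht.2
  have hupper : u (p + s • (x - p)) ≤ u p - ε * δ ^ 2 / 2 := by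
    refine le_sub_half_of_hessian_le (fun t ht ↦ ?_) hdu fun t ht ↦ ?_
    · exact (hsmooth.contDiffAt (hBopen.mem_nhds (hball (hmem t ht)))).of_le
        (WithTop.coe_le_coe.2 le_top)
    · simpa [hw] using hhess _ (hmem t ht) (s • (x - p))
  have hlower := hconc.2 hp hx (sub_nonneg.2 hs1) hs0.le (sub_add_cancel 1 s)
  have hcomb : (1 - s) • p + s • x = p + s • (x - p) := by module
  rw [hcomb, hup, smul_eq_mul, smul_eq_mul] at hlower
  have hsmall : s < ε * δ ^ 2 / 2 := by
    rw [div_lt_iff₀ (by positivity)] at hx'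
    rw [hs, div_lt_iff₀ hr]
    nlinarith
  have hux := mul_pos hs0 (hpos x hx)
  linarith
end

section
/- Let U ⊆ ℝ^{n+1} \ {0} be an open cone, k ≠ 0, and h : U → (0,∞) a smooth positive function positively homogeneous of degree k (h(λx) = λ^k·h(x) for all λ > 0, x ∈ U). Define ψ : U → U by ψ(x) = h(x)^{−1/k}·x. Then for every x ∈ U and all v, w ∈ ℝ^{n+1}: D²h_{ψ(x)}(Dψ_x(v), Dψ_x(w)) = (1/h(x))·D²h_x(v, w) − ((k−1)/(k·h(x)²))·Dh_x(v)·Dh_x(w). -/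
open Set

section Homogeneous

variable {E F : Type*} [NormedAddCommGroup E] [NormedSpace ℝ E]
  [NormedAddCommGroup F] [NormedSpace ℝ F] {U : Set E} {p : ℝ} {g : E → F}

/-- Euler's identity for positively homogeneous functions. -/
theorem fderiv_apply_self_of_homogeneousOn
    (hg : ∀ l : ℝ, 0 < l → ∀ x ∈ U, g (l • x) = l ^ p • g x)
    {x : E} (hx : x ∈ U) (hd : DifferentiableAt ℝ g x) :
    fderiv ℝ g x x = p • g x := by
  have hline : HasDerivAt (fun l : ℝ => l • x) x 1 := by
    simpa using (hasDerivAt_id (1 : ℝ)).smul_const x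
  have hcomp : HasDerivAt (fun l : ℝ => g (l • x)) (fderiv ℝ g x x) 1 := by
    have hd' : HasFDerivAt g (fderiv ℝ g x) ((1 : ℝ) • x) := by
      simpa using hd.hasFDerivAt
    exact hd'.comp_hasDerivAt 1 hline
  have hpow : HasDerivAt (fun l : ℝ => l ^ p • g x) (p • g x) 1 := by
    simpa using (Real.hasDerivAt_rpow_const (x := 1) (p := p) (.inl one_ne_zero)).smul_const (g x)
  refine hcomp.unique (hpow.congr_of_eventuallyEq ?_)
  filter_upwards [eventually_gt_nhds (zero_lt_one' ℝ)] with l hl using hg l hl x hx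

/-- The derivative of a positively homogeneous function of degree `p` is positively homogeneous
of degree `p - 1`. -/
theorem fderiv_smul_of_homogeneousOn (hU : IsOpen U)
    (hg : ∀ l : ℝ, 0 < l → ∀ x ∈ U, g (l • x) = l ^ p • g x) (l : ℝ) (hl : 0 < l)
    (x : E) (hx : x ∈ U) :
    fderiv ℝ g (l • x) = l ^ (p - 1) • fderiv ℝ g x := by
  have heq : (fun y => g (l • y)) =ᶠ[nhds x] fun y => l ^ p • g y := by
    filter_upwards [hU.mem_nhds hx] with y hy using hg l hl y hy
  have hfd := heq.fderiv_eq (𝕜 := ℝ)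
  have hconst : fderiv ℝ (fun y => l ^ p • g y) x = l ^ p • fderiv ℝ g x :=
    congrFun (fderiv_const_smul_field (l ^ p)) x
  rw [fderiv_comp_smul, hconst] at hfd
  rw [Real.rpow_sub_one hl.ne', div_eq_inv_mul, mul_smul, ← hfd, inv_smul_smul₀ hl.ne']

end Homogeneous

/-- Transformation formula for the Hessian of a positively homogeneous
function `h` of degree `k ≠ 0` under the radial projection `ψ(x) = h(x)^{-1/k}·x`
onto the level set `{h = 1}`:
`D²h_{ψ(x)}(Dψ_x v, Dψ_x w) = (1/h(x))·D²h_x(v,w) − ((k−1)/(k·h(x)²))·Dh_x(v)·Dh_x(w)`. -/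
theorem stmt_3 (n : ℕ)
    (U : Set (EuclideanSpace ℝ (Fin (n + 1))))
    (hU0 : (0 : EuclideanSpace ℝ (Fin (n + 1))) ∉ U)
    (hUopen : IsOpen U)
    (hUcone : ∀ l : ℝ, 0 < l → ∀ x ∈ U, l • x ∈ U)
    (k : ℝ) (hk : k ≠ 0)
    (h : EuclideanSpace ℝ (Fin (n + 1)) → ℝ)
    (hpos : ∀ x ∈ U, 0 < h x)
    (hsmooth : ContDiffOn ℝ (⊤ : ℕ∞) h U)
    (hhomog : ∀ l : ℝ, 0 < l → ∀ x ∈ U, h (l • x) = l ^ k * h x)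
    (ψ : EuclideanSpace ℝ (Fin (n + 1)) → EuclideanSpace ℝ (Fin (n + 1)))
    (hψ : ∀ x, ψ x = (h x) ^ (-1 / k) • x) :
    ∀ x ∈ U, ∀ v w : EuclideanSpace ℝ (Fin (n + 1)),
      fderiv ℝ (fderiv ℝ h) (ψ x) (fderiv ℝ ψ x v) (fderiv ℝ ψ x w)
        = (1 / h x) * fderiv ℝ (fderiv ℝ h) x v w
          - ((k - 1) / (k * (h x) ^ 2)) * (fderiv ℝ h x v * fderiv ℝ h x w) := by
  intro x hx v w
  have hsmoothAt : ContDiffAt ℝ (⊤ : ℕ∞) h x := hsmooth.contDiffAt (hUopen.mem_nhds hx)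
  have hd : DifferentiableAt ℝ h x := hsmoothAt.differentiableAt (by simp)
  have hd' : DifferentiableAt ℝ (fderiv ℝ h) x :=
    (hsmoothAt.fderiv_right (m := 1) (by norm_cast)).differentiableAt (by simp)
  have hsymm : IsSymmSndFDerivAt ℝ h x := hsmoothAt.isSymmSndFDerivAt (by
    rw [minSmoothness_of_isRCLikeNormedField]; exact WithTop.coe_le_coe.2 (le_top : (2 : ℕ∞) ≤ ⊤))
  have hfderiv := fderiv_smul_of_homogeneousOn (p := k) hUopen hhomog
  have heuler := fderiv_apply_self_of_homogeneousOn (p := k) hhomog hx hd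
  have heuler' := fderiv_apply_self_of_homogeneousOn hfderiv hx hd'
  have hx0 : 0 < h x := hpos x hx
  set a : ℝ := h x ^ (-1 / k) with ha
  have ha0 : 0 < a := Real.rpow_pos_of_pos hx0 _
  have hak : a ^ k = (h x)⁻¹ := by
    rw [ha, ← Real.rpow_mul hx0.le, div_mul_cancel₀ _ hk, Real.rpow_neg_one]
  have hψd (u : EuclideanSpace ℝ (Fin (n + 1))) :
      fderiv ℝ ψ x u = a • u + (-(a / (k * h x)) * fderiv ℝ h x u) • x := by
    have hr := (hd.hasFDerivAt.rpow_const (p := -1 / k) (.inl hx0.ne')).smul (hasFDerivAt_id x)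
    have hψ' : ψ = (fun y => h y ^ (-1 / k)) • id := funext hψ
    rw [hψ', hr.fderiv]
    simp only [Real.rpow_sub_one hx0.ne', ← ha, add_apply, smul_apply,
      ContinuousLinearMap.id_apply, ContinuousLinearMap.smulRight_apply, id_eq, smul_eq_mul]
    congr 2
    field_simp
  have hscale := fderiv_smul_of_homogeneousOn (g := fderiv ℝ h) hUopen hfderiv a ha0 x hx
  have hxv (u : EuclideanSpace ℝ (Fin (n + 1))) :
      fderiv ℝ (fderiv ℝ h) x x u = (k - 1) * fderiv ℝ h x u := by
    simp [heuler']
  have hvx (u : EuclideanSpace ℝ (Fin (n + 1))) :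
      fderiv ℝ (fderiv ℝ h) x u x = (k - 1) * fderiv ℝ h x u := by
    rw [hsymm.eq, hxv]
  rw [hψ x, ← ha, hscale, hψd, hψd, Real.rpow_sub_one ha0.ne', Real.rpow_sub_one ha0.ne', hak]
  simp only [map_add, map_smul, add_apply, smul_apply, smul_eq_mul, hxv, hvx, heuler]
  field_simp
  ring
end

section
/- Let B ⊆ ℝ^n be an open convex set, k > 0, ε ∈ (0, k), and h̄ : B → (0,∞) a smooth positive function. Suppose that the function f := h̄^{1/(k−ε)} is concave on B. Then for every x ∈ B and every v ∈ ℝ^n: −(1/(k·h̄(x)))·D²h̄_x(v, v) + ((k−1)/(k²·h̄(x)²))·(Dh̄_x(v))² ≥ (ε/(k²·(k−ε)))·(Dh̄_x(v)/h̄(x))². -/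
open Set

/-- A concave function on an open subset of the line has nonpositive second derivative. -/
theorem ConcaveOn.second_deriv_nonpos {S : Set ℝ} (hS : IsOpen S) {f g : ℝ → ℝ} {x c : ℝ}
    (hf : ConcaveOn ℝ S f) (hfg : ∀ y ∈ S, HasDerivAt f (g y) y) (hx : x ∈ S)
    (hg : HasDerivAt g c x) : c ≤ 0 := by
  have hanti : AntitoneOn g S :=
    (hf.antitoneOn_deriv fun y hy => (hfg y hy).differentiableAt).congr
      fun y hy => (hfg y hy).deriv
  have h := hanti.derivWithin_nonpos (x := x)
  rwa [derivWithin_of_isOpen hS hx, hg.deriv] at h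

/-- If a positive power `h ^ p` is concave on an open set, then
`h * D²h(v, v) ≤ (1 - p) * (Dh v) ^ 2`. -/
theorem mul_fderiv_fderiv_le_of_concaveOn_rpow {E : Type*} [NormedAddCommGroup E]
    [NormedSpace ℝ E] {B : Set E} (hB : IsOpen B) {h : E → ℝ} {p : ℝ} (hp : 0 < p)
    (hpos : ∀ x ∈ B, 0 < h x) (hh : ContDiffOn ℝ 2 h B)
    (hconc : ConcaveOn ℝ B fun x => h x ^ p) {x : E} (hx : x ∈ B) (v : E) :
    h x * fderiv ℝ (fderiv ℝ h) x v v ≤ (1 - p) * fderiv ℝ h x v ^ 2 := by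
  have hline : ∀ t : ℝ, HasDerivAt (fun s : ℝ => x + s • v) v t := fun t => by
    simpa using ((hasDerivAt_id t).smul_const v).const_add x
  have hcont : Continuous fun s : ℝ => x + s • v := by fun_prop
  have hB' : IsOpen ((fun s : ℝ => x + s • v) ⁻¹' B) := hB.preimage hcont
  have hconc' : ConcaveOn ℝ ((fun s : ℝ => x + s • v) ⁻¹' B) fun s => h (x + s • v) ^ p := by
    have hl : ⇑(AffineMap.lineMap x (x + v) : ℝ →ᵃ[ℝ] E) = fun s => x + s • v := by
      ext s
      simp [AffineMap.lineMap_apply, add_comm]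
    have hc := hconc.comp_affineMap (AffineMap.lineMap x (x + v) : ℝ →ᵃ[ℝ] E)
    rw [hl] at hc
    exact hc
  have hd : ∀ t : ℝ, x + t • v ∈ B →
      HasDerivAt (fun s : ℝ => h (x + s • v)) (fderiv ℝ h (x + t • v) v) t := fun t ht =>
    (((hh.contDiffAt (hB.mem_nhds ht)).differentiableAt
      (by norm_num)).hasFDerivAt).comp_hasDerivAt t (hline t)
  have h0 : x + (0 : ℝ) • v ∈ B := by simpa using hx
  have hd2 : HasDerivAt (fun s : ℝ => fderiv ℝ h (x + s • v) v)
      (fderiv ℝ (fderiv ℝ h) (x + (0 : ℝ) • v) v v) 0 := by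
    have hF : ContDiffAt ℝ 1 (fderiv ℝ h) (x + (0 : ℝ) • v) :=
      (hh.contDiffAt (hB.mem_nhds h0)).fderiv_right (by norm_num)
    have := ((hF.differentiableAt (by norm_num)).hasFDerivAt).comp_hasDerivAt 0 (hline 0)
    simpa using this.clm_apply (hasDerivAt_const (0 : ℝ) v)
  have key := hconc'.second_deriv_nonpos hB'
    (fun t ht => (hd t ht).rpow_const (p := p) (Or.inl (hpos _ ht).ne')) h0
    ((hd2.mul_const p).mul
      ((hd 0 h0).rpow_const (p := p - 1) (Or.inl (hpos _ h0).ne')))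
  simp only [zero_smul, add_zero] at key
  have hx0 := hpos x hx
  have e : h x ^ (p - 1) = h x ^ (p - 1 - 1) * h x := by
    rw [Real.rpow_sub_one hx0.ne' (p - 1)]
    field_simp
  rw [e] at key
  have hq : 0 < p * h x ^ (p - 1 - 1) := mul_pos hp (Real.rpow_pos_of_pos hx0 _)
  refine le_of_mul_le_mul_left ?_ hq
  linarith

/-- If `h̄` is a smooth positive function on an open convex set
`B ⊆ ℝ^n`, `k > 0`, `ε ∈ (0,k)`, and `f := h̄^{1/(k−ε)}` is concave on `B`, then
the centroaffine metric expression satisfies the key lower estimate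
`−(1/(k·h̄))·D²h̄(v,v) + ((k−1)/(k²·h̄²))·(Dh̄ v)² ≥ (ε/(k²(k−ε)))·(Dh̄ v / h̄)²`. -/
theorem stmt_5 (n : ℕ)
    (B : Set (EuclideanSpace ℝ (Fin n))) (hBopen : IsOpen B) (hBconv : Convex ℝ B)
    (k ε : ℝ) (hk : 0 < k) (hε : 0 < ε) (hεk : ε < k)
    (hbar : EuclideanSpace ℝ (Fin n) → ℝ)
    (hpos : ∀ x ∈ B, 0 < hbar x)
    (hsmooth : ContDiffOn ℝ (⊤ : ℕ∞) hbar B)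
    (hconc : ConcaveOn ℝ B (fun x => (hbar x) ^ (1 / (k - ε)))) :
    ∀ x ∈ B, ∀ v : EuclideanSpace ℝ (Fin n),
      -(1 / (k * hbar x)) * fderiv ℝ (fderiv ℝ hbar) x v v
        + ((k - 1) / (k ^ 2 * (hbar x) ^ 2)) * (fderiv ℝ hbar x v) ^ 2
      ≥ (ε / (k ^ 2 * (k - ε))) * (fderiv ℝ hbar x v / hbar x) ^ 2 := by
  intro x hx v
  have hkε : 0 < k - ε := sub_pos.2 hεk
  have hx0 := hpos x hx
  have key := mul_fderiv_fderiv_le_of_concaveOn_rpow hBopen (one_div_pos.2 hkε) hpos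
    (hsmooth.of_le (WithTop.coe_le_coe.2 (le_top : (2 : ℕ∞) ≤ ⊤))) hconc hx v
  set a := fderiv ℝ (fderiv ℝ hbar) x v v
  set d := fderiv ℝ hbar x v
  rw [ge_iff_le, ← sub_nonneg]
  have e : -(1 / (k * hbar x)) * a + ((k - 1) / (k ^ 2 * (hbar x) ^ 2)) * d ^ 2
      - (ε / (k ^ 2 * (k - ε))) * (d / hbar x) ^ 2
      = ((1 - 1 / (k - ε)) * d ^ 2 - hbar x * a) / (k * hbar x ^ 2) := by
    field_simp
    ring
  rw [e]
  exact div_nonneg (sub_nonneg.2 key) (by positivity)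
end

section
/- Let V ⊆ ℝ^{n+1} be an open cone, k > 0, and h : V → ℝ a smooth function positively homogeneous of degree k. Let H be a connected component of {x ∈ V : h(x) = 1} that is a closed subset of ℝ^{n+1}, with D²h_p negative definite on ker Dh_p for every p ∈ H; set U := {λx : λ > 0, x ∈ H} and extend h to U by h(λx) := λ^k for x ∈ H, λ > 0. Let p ∈ H and suppose there exists ε ∈ (0, k) such that the function x ↦ h(x)^{1/(k−ε)} is concave on the convex set U ∩ (p + ker Dh_p). Then for every T ∈ (0, ∞] and every smooth curve γ : [0, T) → H that is not contained in any compact subset of H, the centroaffine length ∫₀^T √(−(1/k)·D²h_{γ(t)}(γ'(t), γ'(t))) dt is infinite. -/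
open Set MeasureTheory ENNReal

section Helpers

open Filter Topology

lemma le_of_concaveOn_rpow {φ φ' : ℝ → ℝ} {b q δ : ℝ} (hδ : 0 < δ) (hq : 0 < q)
    (hφ : ∀ s ∈ Ioo (-δ) δ, HasDerivAt φ (φ' s) s) (hφ' : HasDerivAt φ' b 0) (h0 : φ 0 = 1)
    (hpos : ∀ s ∈ Ioo (-δ) δ, 0 < φ s) (hconc : ConcaveOn ℝ (Ioo (-δ) δ) fun s ↦ φ s ^ q) :
    b ≤ (1 - q) * φ' 0 ^ 2 := by
  have h0mem : (0 : ℝ) ∈ Ioo (-δ) δ := ⟨by linarith, hδ⟩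
  have hd : ∀ s ∈ Ioo (-δ) δ, HasDerivAt (fun s ↦ φ s ^ q) (φ' s * q * φ s ^ (q - 1)) s :=
    fun s hs ↦ (hφ s hs).rpow_const (Or.inl (hpos s hs).ne')
  have hanti : AntitoneOn (fun s ↦ φ' s * q * φ s ^ (q - 1)) (Ioo (-δ) δ) :=
    (hconc.antitoneOn_deriv fun s hs ↦ (hd s hs).differentiableAt).congr
      fun s hs ↦ (hd s hs).deriv
  have hd2 := (hφ'.mul_const q).mul ((hφ 0 h0mem).rpow_const (p := q - 1) (Or.inl (by simp [h0])))
  have hnonpos := hanti.derivWithin_nonpos (x := 0)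
  rw [derivWithin_of_mem_nhds (isOpen_Ioo.mem_nhds h0mem)] at hnonpos
  have := hd2.deriv
  simp only [Pi.mul_def, h0, Real.one_rpow] at this
  rw [this] at hnonpos
  have : q * (b - (1 - q) * φ' 0 ^ 2) ≤ 0 := by linarith
  have := nonpos_of_mul_nonpos_right this hq
  linarith

section Cone

variable {E : Type*} [NormedAddCommGroup E] [NormedSpace ℝ E] {V : Set E} {h : E → ℝ} {k : ℝ}

lemma fderiv_apply_self_of_homogeneous_s6
    (hhomog : ∀ l : ℝ, 0 < l → ∀ x ∈ V, h (l • x) = l ^ k * h x) {x : E} (hx : x ∈ V)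
    (hd : DifferentiableAt ℝ h x) : fderiv ℝ h x x = k * h x := by
  have hl : HasDerivAt (fun l : ℝ ↦ l • x) x 1 := by
    simpa using (hasDerivAt_id (1 : ℝ)).smul_const x
  have h1 : HasDerivAt (fun l : ℝ ↦ h (l • x)) (fderiv ℝ h x x) 1 := by
    have hd' : HasFDerivAt h (fderiv ℝ h x) ((1 : ℝ) • x) := by simpa using hd.hasFDerivAt
    exact hd'.comp_hasDerivAt 1 hl
  have h2 : HasDerivAt (fun l : ℝ ↦ l ^ k * h x) (k * h x) 1 := by
    simpa using (Real.hasDerivAt_rpow_const (x := 1) (p := k) (Or.inl one_ne_zero)).mul_const (h x)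
  refine h1.unique (h2.congr_of_eventuallyEq ?_)
  filter_upwards [lt_mem_nhds zero_lt_one] with l hl using hhomog l hl x hx

lemma fderiv_fderiv_apply_self_of_homogeneous (hVopen : IsOpen V)
    (hsmooth : ContDiffOn ℝ 2 h V)
    (hhomog : ∀ l : ℝ, 0 < l → ∀ x ∈ V, h (l • x) = l ^ k * h x) {x : E} (hx : x ∈ V) (v : E) :
    fderiv ℝ (fderiv ℝ h) x v x = (k - 1) * fderiv ℝ h x v := by
  have hc := hsmooth.contDiffAt (hVopen.mem_nhds hx)
  have hd : DifferentiableAt ℝ h x := hc.differentiableAt (by simp)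
  have hd2 : DifferentiableAt ℝ (fderiv ℝ h) x :=
    (hc.fderiv_right (m := 1) (by norm_num [one_add_one_eq_two])).differentiableAt (by simp)
  have h1 := hd2.hasFDerivAt.clm_apply (hasFDerivAt_id x)
  have h2 := (hd.hasFDerivAt.const_mul k)
  have : (fun y ↦ fderiv ℝ h y (id y)) =ᶠ[𝓝 x] fun y ↦ k * h y := by
    filter_upwards [hVopen.mem_nhds hx] with y hy
    exact fderiv_apply_self_of_homogeneous_s6 hhomog hy
      ((hsmooth.contDiffAt (hVopen.mem_nhds hy)).differentiableAt (by simp))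
  have := congrArg (fun L ↦ L v) (h1.unique (h2.congr_of_eventuallyEq this))
  simp at this
  linarith

lemma hasDerivAt_comp_line (hVopen : IsOpen V) (hsmooth : ContDiffOn ℝ 2 h V) {x w : E} {s : ℝ}
    (hs : x + s • w ∈ V) :
    HasDerivAt (fun s : ℝ ↦ h (x + s • w)) (fderiv ℝ h (x + s • w) w) s := by
  have hl : HasDerivAt (fun l : ℝ ↦ x + l • w) w s := by
    simpa using ((hasDerivAt_id s).smul_const w).const_add x
  exact ((hsmooth.contDiffAt (hVopen.mem_nhds hs)).differentiableAt
    (by simp)).hasFDerivAt.comp_hasDerivAt s hl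

lemma hasDerivAt_fderiv_comp_line (hVopen : IsOpen V) (hsmooth : ContDiffOn ℝ 2 h V) {x : E} (w : E)
    (hx : x ∈ V) :
    HasDerivAt (fun s : ℝ ↦ fderiv ℝ h (x + s • w) w) (fderiv ℝ (fderiv ℝ h) x w w) 0 := by
  have hl : HasDerivAt (fun l : ℝ ↦ x + l • w) w 0 := by
    simpa using ((hasDerivAt_id (0 : ℝ)).smul_const w).const_add x
  have hd2 : DifferentiableAt ℝ (fderiv ℝ h) x :=
    ((hsmooth.contDiffAt (hVopen.mem_nhds hx)).fderiv_right (m := 1)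
      (by norm_num [one_add_one_eq_two])).differentiableAt (by simp)
  have hd' : HasFDerivAt (fderiv ℝ h) (fderiv ℝ (fderiv ℝ h) x) (x + (0 : ℝ) • w) := by
    simpa using hd2.hasFDerivAt
  exact (ContinuousLinearMap.apply ℝ ℝ w).hasFDerivAt.comp_hasDerivAt (0 : ℝ)
    (hd'.comp_hasDerivAt (0 : ℝ) hl)

/-- The cone over a connected component of a level set of a homogeneous function is open. -/
lemma isOpen_cone_connectedComponentIn (hVopen : IsOpen V)
    (hVcone : ∀ l : ℝ, 0 < l → ∀ x ∈ V, l • x ∈ V) (hk : 0 < k) (hcont : ContinuousOn h V)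
    (hhomog : ∀ l : ℝ, 0 < l → ∀ x ∈ V, h (l • x) = l ^ k * h x) {x₀ : E} (hx₀V : x₀ ∈ V)
    (hx₀ : h x₀ = 1) :
    IsOpen {y | ∃ l : ℝ, 0 < l ∧ ∃ x ∈ connectedComponentIn {x ∈ V | h x = 1} x₀, y = l • x} := by
  set W : Set E := {x ∈ V | 0 < h x}
  have hWopen : IsOpen W := hcont.isOpen_inter_preimage hVopen isOpen_Ioi
  have hx₀W : x₀ ∈ W := ⟨hx₀V, by simp [hx₀]⟩
  have hx₀Z : x₀ ∈ {x ∈ V | h x = 1} := ⟨hx₀V, hx₀⟩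
  suffices h_eq : {y | ∃ l : ℝ, 0 < l ∧ ∃ x ∈ connectedComponentIn {x ∈ V | h x = 1} x₀, y = l • x} =
      connectedComponentIn W x₀ by
    rw [h_eq]; exact hWopen.connectedComponentIn
  apply Subset.antisymm
  · have himg : {y | ∃ l : ℝ, 0 < l ∧ ∃ x ∈ connectedComponentIn {x ∈ V | h x = 1} x₀, y = l • x} =
        (fun z : ℝ × E ↦ z.1 • z.2) ''
          (Ioi (0 : ℝ) ×ˢ connectedComponentIn {x ∈ V | h x = 1} x₀) := by
      ext y
      constructor
      · rintro ⟨l, hl, x, hx, rfl⟩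
        exact ⟨(l, x), ⟨hl, hx⟩, rfl⟩
      · rintro ⟨⟨l, x⟩, ⟨hl, hx⟩, rfl⟩
        exact ⟨l, hl, x, hx, rfl⟩
    refine IsPreconnected.subset_connectedComponentIn ?_ ?_ ?_
    · rw [himg]
      exact (isPreconnected_Ioi.prod isPreconnected_connectedComponentIn).image _
        (by fun_prop)
    · exact ⟨1, one_pos, x₀, mem_connectedComponentIn hx₀Z, by simp⟩
    · rintro _ ⟨l, hl, x, hx, rfl⟩
      have hx' := connectedComponentIn_subset _ _ hx
      refine ⟨hVcone l hl x hx'.1, ?_⟩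
      rw [hhomog l hl x hx'.1, hx'.2]
      positivity
  · have hr : ContinuousOn (fun x ↦ h x ^ (-(1 / k)) • x) W :=
      ((hcont.mono fun x hx ↦ hx.1).rpow_const fun x hx ↦ Or.inl hx.2.ne').smul continuousOn_id
    have hsub : (fun x ↦ h x ^ (-(1 / k)) • x) '' connectedComponentIn W x₀ ⊆
        connectedComponentIn {x ∈ V | h x = 1} x₀ := by
      refine IsPreconnected.subset_connectedComponentIn
        (isPreconnected_connectedComponentIn.image _ (hr.mono (connectedComponentIn_subset _ _)))
        ⟨x₀, mem_connectedComponentIn hx₀W, by simp [hx₀]⟩ ?_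
      rintro _ ⟨x, hx, rfl⟩
      have hx' := connectedComponentIn_subset _ _ hx
      have hpos : 0 < h x := hx'.2
      refine ⟨hVcone _ (by positivity) x hx'.1, ?_⟩
      rw [hhomog _ (by positivity) x hx'.1, ← Real.rpow_mul hpos.le]
      rw [show -(1 / k) * k = -1 by field_simp, Real.rpow_neg_one]
      exact inv_mul_cancel₀ hpos.ne'
    intro x hx
    have hpos : 0 < h x := (connectedComponentIn_subset _ _ hx).2
    refine ⟨h x ^ (1 / k), by positivity, _, hsub ⟨x, hx, rfl⟩, ?_⟩
    rw [smul_smul, ← Real.rpow_add hpos]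
    simp

/-- A concave nonnegative function with a strict maximum at a relative interior point has a bounded
domain. -/
lemma ConcaveOn.isBounded_of_strict_max [FiniteDimensional ℝ E] {A : Set E} {F : E → ℝ} {p : E}
    {D : E →L[ℝ] ℝ} (hconc : ConcaveOn ℝ A F) (hnonneg : ∀ x ∈ A, 0 ≤ F x) (hp : p ∈ A)
    (hA : ∀ x ∈ A, D (x - p) = 0) (hcont : ContinuousOn F A)
    (hmax : ∀ x ∈ A, x ≠ p → F x < F p)
    (hball : ∃ r > 0, ∀ x, dist x p ≤ r → D (x - p) = 0 → x ∈ A) :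
    Bornology.IsBounded A := by
  obtain ⟨r, hr, hball⟩ := hball
  set S : Set E := Metric.sphere p r ∩ {x | D (x - p) = 0}
  have hScomp : IsCompact S :=
    (isCompact_sphere p r).inter_right (isClosed_eq (by fun_prop) (by fun_prop))
  have hSA : S ⊆ A := fun x hx ↦ hball x hx.1.le hx.2
  obtain ⟨M, hM, hSM⟩ : ∃ M < F p, ∀ x ∈ S, F x ≤ M := by
    rcases S.eq_empty_or_nonempty with hS | hS
    · exact ⟨F p - 1, by linarith, by simp [hS]⟩
    · obtain ⟨z, hz, hzmax⟩ := hScomp.exists_isMaxOn hS (hcont.mono hSA)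
      refine ⟨F z, hmax z (hSA hz) ?_, fun x hx ↦ hzmax hx⟩
      rintro rfl
      have : dist z z = r := hz.1
      simp at this
      linarith
  refine (Metric.isBounded_iff_subset_closedBall p).2 ⟨max r (r * F p / (F p - M)), fun y hy ↦ ?_⟩
  rw [Metric.mem_closedBall]
  by_contra! hlt
  obtain ⟨h1, h2⟩ := max_lt_iff.1 hlt
  set R := dist y p
  have hR : 0 < R := hr.trans h1
  have hmem : p + (r / R) • (y - p) ∈ S := by
    refine ⟨?_, ?_⟩
    · rw [Metric.mem_sphere, dist_eq_norm, add_sub_cancel_left, norm_smul, ← dist_eq_norm,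
        Real.norm_of_nonneg (by positivity)]
      exact div_mul_cancel₀ _ hR.ne'
    · simp only [Set.mem_ofPred_eq, add_sub_cancel_left, map_smul, hA y hy, smul_zero]
  have hrR : r / R ≤ 1 := (div_le_one hR).2 h1.le
  have hc := hconc.2 hp hy (sub_nonneg.2 hrR) (by positivity) (sub_add_cancel 1 (r / R))
  have he : (1 - r / R) • p + (r / R) • y = p + (r / R) • (y - p) := by module
  rw [he] at hc
  have h3 := hSM _ hmem
  have h4 := hnonneg y hy
  simp only [smul_eq_mul] at hc
  have h5 : 0 ≤ r / R * F y := by positivity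
  rw [div_lt_iff₀ (by linarith)] at h2
  have h6 : (1 - r / R) * F p ≤ M := by linarith
  have h7 : F p - M ≤ r * F p / R := by
    have : r * F p / R = r / R * F p := by ring
    linarith
  rw [le_div_iff₀ hR] at h7
  linarith

lemma concaveOn_rpow_comp_line {U : Set E} {D : E →L[ℝ] ℝ} {q δ : ℝ} (hk : 0 < k)
    (hUcone : ∀ l : ℝ, 0 < l → ∀ x ∈ U, l • x ∈ U) (hUpos : ∀ x ∈ U, 0 < h x)
    (hhomog : ∀ l : ℝ, 0 < l → ∀ x ∈ U, h (l • x) = l ^ k * h x)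
    (hconc : ConcaveOn ℝ (U ∩ {x | D x = k}) fun x ↦ h x ^ q) {x w : E}
    (hDx : 0 < D x) (hDw : D w = 0) (hδ : ∀ s ∈ Ioo (-δ) δ, x + s • w ∈ U) :
    ConcaveOn ℝ (Ioo (-δ) δ) fun s ↦ h (x + s • w) ^ q := by
  set c := k / D x with hc
  have hcpos : 0 < c := by positivity
  let g : ℝ →ᵃ[ℝ] E := AffineMap.lineMap (c • x) (c • (x + w))
  have hg : ∀ s, g s = c • (x + s • w) := by
    intro s
    simp only [g, AffineMap.lineMap_apply_module]
    module
  have hsub : Ioo (-δ) δ ⊆ g ⁻¹' (U ∩ {x | D x = k}) := by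
    intro s hs
    rw [mem_preimage, hg]
    refine ⟨hUcone c hcpos _ (hδ s hs), ?_⟩
    simp [hDw, hc, hDx.ne']
  have h1 := ((hconc.comp_affineMap g).subset hsub (convex_Ioo _ _)).smul
    (show 0 ≤ (c ^ k) ^ (-q) by positivity)
  refine h1.congr fun s hs ↦ ?_
  have hpos := hUpos _ (hδ s hs)
  have hck : 0 < c ^ k := by positivity
  simp only [Function.comp, hg, smul_eq_mul]
  rw [hhomog c hcpos _ (hδ s hs), Real.mul_rpow hck.le hpos.le, ← mul_assoc,
    ← Real.rpow_add hck]
  simp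

/-- The centroaffine metric dominates a multiple of the square of the logarithmic derivative of a
linear form if a suitable power of `h` is concave on a level set of that form. -/
lemma centroaffine_metric_lower_bound (hVopen : IsOpen V) (hsmooth : ContDiffOn ℝ 2 h V)
    (hhomog : ∀ l : ℝ, 0 < l → ∀ x ∈ V, h (l • x) = l ^ k * h x) {U : Set E} (hUopen : IsOpen U)
    (hUV : U ⊆ V) (hk : 0 < k) (hUcone : ∀ l : ℝ, 0 < l → ∀ x ∈ U, l • x ∈ U)
    (hUpos : ∀ x ∈ U, 0 < h x) {D : E →L[ℝ] ℝ} {m : ℝ} (hm : 0 < m)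
    (hconc : ConcaveOn ℝ (U ∩ {x | D x = k}) fun x ↦ h x ^ (1 / m)) {x v : E} (hx : x ∈ U)
    (hx1 : h x = 1) (hDx : 0 < D x) (hv : fderiv ℝ h x v = 0) :
    (k / m - 1) * (D v / D x) ^ 2 ≤ -(1 / k) * fderiv ℝ (fderiv ℝ h) x v v := by
  set c := D v / D x with hc
  set w := v - c • x with hw
  have hDw : D w = 0 := by simp [hw, hc, hDx.ne']
  have hopen : IsOpen {s : ℝ | x + s • w ∈ U} :=
    hUopen.preimage (f := fun s : ℝ ↦ x + s • w) (by fun_prop)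
  obtain ⟨δ, hδ, hball⟩ := Metric.isOpen_iff.1 hopen 0 (by simpa using hx)
  rw [Real.ball_eq_Ioo, zero_sub, zero_add] at hball
  have key := le_of_concaveOn_rpow hδ (one_div_pos.2 hm)
    (fun s hs ↦ hasDerivAt_comp_line hVopen hsmooth (hUV (hball hs)))
    (hasDerivAt_fderiv_comp_line hVopen hsmooth w (hUV hx)) (by simpa using hx1)
    (fun s hs ↦ hUpos _ (hball hs))
    (concaveOn_rpow_comp_line hk hUcone hUpos (fun l hl x hx ↦ hhomog l hl x (hUV hx)) hconc
      hDx hDw hball)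
  have hcd := hsmooth.contDiffAt (hVopen.mem_nhds (hUV hx))
  have e1 := fderiv_apply_self_of_homogeneous_s6 hhomog (hUV hx) (hcd.differentiableAt (by simp))
  have e2 := fderiv_fderiv_apply_self_of_homogeneous hVopen hsmooth hhomog (hUV hx) v
  have e3 := fderiv_fderiv_apply_self_of_homogeneous hVopen hsmooth hhomog (hUV hx) x
  have e4 : fderiv ℝ (fderiv ℝ h) x x v = fderiv ℝ (fderiv ℝ h) x v x :=
    (hcd.isSymmSndFDerivAt (by simp)) x v
  rw [hx1, mul_one] at e1
  rw [hv, mul_zero] at e2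
  rw [e1] at e3
  rw [e2] at e4
  simp only [hw, zero_smul, add_zero, map_sub, map_smul, _root_.sub_apply,
    _root_.smul_apply, smul_eq_mul, hv, e1, e2, e3, e4] at key
  have h2 : fderiv ℝ (fderiv ℝ h) x v v ≤ k * (1 - k / m) * c ^ 2 := by
    have : k * (1 - k / m) * c ^ 2 = (1 - 1 / m) * (0 - c * k) ^ 2 - c * (c * ((k - 1) * k)) := by
      field_simp
      ring
    linarith
  calc (k / m - 1) * c ^ 2 = -(1 / k) * (k * (1 - k / m) * c ^ 2) := by field_simp; ring
    _ ≤ _ := mul_le_mul_of_nonpos_left h2 (by simp [hk.le])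

/-- On a convex set through the critical point `p` in directions tangent to the level set of `h`, a
function with a concave power has a strict maximum at `p` if its Hessian is negative definite. -/
lemma lt_of_concaveOn_rpow (hVopen : IsOpen V) (hsmooth : ContDiffOn ℝ 2 h V) {A : Set E} {p : E}
    {q : ℝ} (hq : 0 < q) (hAV : A ⊆ V) (hApos : ∀ x ∈ A, 0 < h x) (hp : p ∈ A) (hp1 : h p = 1)
    (hA : ∀ x ∈ A, fderiv ℝ h p (x - p) = 0)
    (hhyp : ∀ v, fderiv ℝ h p v = 0 → v ≠ 0 → fderiv ℝ (fderiv ℝ h) p v v < 0)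
    (hconc : ConcaveOn ℝ A fun x ↦ h x ^ q) {y : E} (hy : y ∈ A) (hyp : y ≠ p) : h y < 1 := by
  have hle : ∀ y ∈ A, h y ≤ 1 := by
    intro y hy
    let g : ℝ →ᵃ[ℝ] E := AffineMap.lineMap p y
    have hg : ∀ s, g s = p + s • (y - p) := by
      intro s
      simp only [g, AffineMap.lineMap_apply_module]
      module
    have hc := hconc.comp_affineMap g
    have hd := (hasDerivAt_comp_line (s := 0) (w := y - p) (x := p) hVopen hsmooth
      (by simpa using hAV hp)).rpow_const (p := q) (Or.inl (by simp [hp1]))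
    simp only [zero_smul, add_zero, hA y hy, zero_mul] at hd
    have hs := hc.slope_le_of_hasDerivAt (x := 0) (y := 1) (f' := 0)
      (by simpa [g] using hp) (by simpa [g] using hy) one_pos
      (by simpa only [Function.comp_def, hg] using hd)
    simp only [slope_def_field, Function.comp, hg] at hs
    simp only [one_smul, add_sub_cancel, zero_smul, add_zero, hp1, Real.one_rpow, sub_zero,
      div_one, sub_nonpos] at hs
    by_contra! hlt
    exact absurd hs (Real.one_lt_rpow hlt hq).not_ge
  refine lt_of_le_of_ne (hle y hy) fun hy1 ↦ ?_
  have hseg : ∀ s ∈ Icc (0 : ℝ) 1, p + s • (y - p) ∈ A ∧ h (p + s • (y - p)) = 1 := by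
    intro s hs
    have hmem : p + s • (y - p) ∈ A := hconc.1.add_smul_sub_mem hp hy hs
    refine ⟨hmem, le_antisymm (hle _ hmem) ?_⟩
    have hc := hconc.2 hp hy (sub_nonneg.2 hs.2) hs.1 (sub_add_cancel 1 s)
    rw [show (1 - s) • p + s • y = p + s • (y - p) by module] at hc
    simp only [hp1, hy1, Real.one_rpow, smul_eq_mul, mul_one, sub_add_cancel] at hc
    by_contra! hlt
    exact absurd hc (Real.rpow_lt_one (hApos _ hmem).le hlt hq).not_ge
  have hd2 := (hasDerivAt_fderiv_comp_line hVopen hsmooth (y - p) (hAV hp)).hasDerivWithinAt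
    (s := Ioi 0)
  have hzero : HasDerivWithinAt (fun s : ℝ ↦ fderiv ℝ h (p + s • (y - p)) (y - p)) 0 (Ioi 0) 0 := by
    refine (hasDerivWithinAt_const (0 : ℝ) (Ioi 0) (0 : ℝ)).congr_of_eventuallyEq ?_
      (by simpa using hA y hy)
    filter_upwards [Ioo_mem_nhdsGT (zero_lt_one (α := ℝ))] with s hs
    have h1 := hasDerivAt_comp_line hVopen hsmooth (hAV (hseg s ⟨hs.1.le, hs.2.le⟩).1)
    refine h1.unique ((hasDerivAt_const s (1 : ℝ)).congr_of_eventuallyEq ?_)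
    filter_upwards [isOpen_Ioo.mem_nhds hs] with t ht using (hseg t ⟨ht.1.le, ht.2.le⟩).2
  have := (uniqueDiffWithinAt_Ioi (0 : ℝ)).eq_deriv _ hd2 hzero
  exact absurd this (hhyp _ (hA y hy) (sub_ne_zero.2 hyp)).ne

end Cone

/-- A function on an interval starting at `0` is bounded if a multiple of the absolute value of its
derivative is dominated by a function with finite integral. -/
lemma exists_abs_sub_le_of_mul_abs_deriv_le {θ g : ℝ → ℝ} {S : Set ℝ} {κ : ℝ} (hκ : 0 < κ)
    (hS : ∀ b ∈ S, 0 ≤ b ∧ Icc 0 b ⊆ S) (hθ : ContDiffOn ℝ 1 θ S)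
    (hle : ∀ t, S ∈ 𝓝 t → κ * |deriv θ t| ≤ g t)
    (hfin : ∫⁻ t in S, ENNReal.ofReal (g t) ≠ ⊤) :
    ∃ B, ∀ b ∈ S, |θ b - θ 0| ≤ B := by
  refine ⟨κ⁻¹ * (∫⁻ t in S, ENNReal.ofReal (g t)).toReal, fun b hbS ↦ ?_⟩
  obtain ⟨hb, hbIcc⟩ := hS b hbS
  have h1 : ‖θ b - θ 0‖ₑ ≤ ENNReal.ofReal κ⁻¹ * ∫⁻ t in S, ENNReal.ofReal (g t) :=
    calc ‖θ b - θ 0‖ₑ ≤ ∫⁻ t in Icc 0 b, ‖deriv θ t‖ₑ :=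
          enorm_sub_le_lintegral_deriv_of_contDiffOn_Icc (hθ.mono hbIcc) hb
      _ = ∫⁻ t in Ioo 0 b, ‖deriv θ t‖ₑ := by rw [restrict_Ioo_eq_restrict_Icc]
      _ ≤ ∫⁻ t in Ioo 0 b, ENNReal.ofReal κ⁻¹ * ENNReal.ofReal (g t) := by
          refine setLIntegral_mono' measurableSet_Ioo fun t ht ↦ ?_
          rw [← ENNReal.ofReal_mul (by positivity), Real.enorm_eq_ofReal_abs]
          refine ENNReal.ofReal_le_ofReal ?_
          rw [inv_mul_eq_div, le_div_iff₀ hκ, mul_comm]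
          exact hle t (mem_of_superset (isOpen_Ioo.mem_nhds ht)
            (Ioo_subset_Icc_self.trans hbIcc))
      _ = ENNReal.ofReal κ⁻¹ * ∫⁻ t in Ioo 0 b, ENNReal.ofReal (g t) :=
          lintegral_const_mul' _ _ ENNReal.ofReal_ne_top
      _ ≤ _ := by
          gcongr
          exact Ioo_subset_Icc_self.trans hbIcc
  have h2 := ENNReal.toReal_mono (ENNReal.mul_ne_top ENNReal.ofReal_ne_top hfin) h1
  rwa [ENNReal.toReal_mul, ENNReal.toReal_ofReal (by positivity), toReal_enorm,
    Real.norm_eq_abs] at h2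

end Helpers

/-- key completeness lemma: Let `H` be a closed connected component
of the level set `{h = 1}` of a smooth positively homogeneous function of degree
`k > 0` on an open cone `V`, hyperbolic (Hessian negative definite on tangent
spaces), and let `U = ℝ^{>0}·H` (on which `h(λx) = λ^k`, consistently with the
homogeneous extension). If for some `p ∈ H` and some `ε ∈ (0,k)` the function
`x ↦ h(x)^{1/(k−ε)}` is concave on `U ∩ (p + ker Dh_p)`, then every smooth curve
`γ : [0,T) → H` not contained in any compact subset of `H` has infinite
centroaffine length. -/
theorem stmt_6 (n : ℕ)
    (V : Set (EuclideanSpace ℝ (Fin (n + 1)))) (hVopen : IsOpen V)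
    (hVcone : ∀ l : ℝ, 0 < l → ∀ x ∈ V, l • x ∈ V)
    (k : ℝ) (hk : 0 < k)
    (h : EuclideanSpace ℝ (Fin (n + 1)) → ℝ)
    (hsmooth : ContDiffOn ℝ (⊤ : ℕ∞) h V)
    (hhomog : ∀ l : ℝ, 0 < l → ∀ x ∈ V, h (l • x) = l ^ k * h x)
    (H : Set (EuclideanSpace ℝ (Fin (n + 1))))
    (x₀ : EuclideanSpace ℝ (Fin (n + 1))) (hx₀V : x₀ ∈ V) (hx₀1 : h x₀ = 1)
    (hH : H = connectedComponentIn {x ∈ V | h x = 1} x₀)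
    (hHclosed : IsClosed H)
    (hhyp : ∀ p ∈ H, ∀ v : EuclideanSpace ℝ (Fin (n + 1)),
      fderiv ℝ h p v = 0 → v ≠ 0 → fderiv ℝ (fderiv ℝ h) p v v < 0)
    (U : Set (EuclideanSpace ℝ (Fin (n + 1))))
    (hU : U = {y | ∃ l : ℝ, 0 < l ∧ ∃ x ∈ H, y = l • x})
    (p : EuclideanSpace ℝ (Fin (n + 1))) (hp : p ∈ H)
    (ε : ℝ) (hε : 0 < ε) (hεk : ε < k)
    (hconc : ConcaveOn ℝ (U ∩ {x | fderiv ℝ h p (x - p) = 0})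
      (fun x => (h x) ^ (1 / (k - ε)))) :
    ∀ T : ℝ≥0∞, 0 < T →
      ∀ γ : ℝ → EuclideanSpace ℝ (Fin (n + 1)),
        ContDiffOn ℝ (⊤ : ℕ∞) γ {t : ℝ | 0 ≤ t ∧ ENNReal.ofReal t < T} →
        (∀ t, 0 ≤ t → ENNReal.ofReal t < T → γ t ∈ H) →
        (¬ ∃ K : Set (EuclideanSpace ℝ (Fin (n + 1))), IsCompact K ∧ K ⊆ H ∧
          γ '' {t : ℝ | 0 ≤ t ∧ ENNReal.ofReal t < T} ⊆ K) →
        ∫⁻ t in {t : ℝ | 0 ≤ t ∧ ENNReal.ofReal t < T},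
          ENNReal.ofReal (Real.sqrt (-(1 / k) *
            fderiv ℝ (fderiv ℝ h) (γ t)
              (derivWithin γ {t : ℝ | 0 ≤ t ∧ ENNReal.ofReal t < T} t)
              (derivWithin γ {t : ℝ | 0 ≤ t ∧ ENNReal.ofReal t < T} t))) = ⊤ := by
  have hsmooth2 : ContDiffOn ℝ 2 h V := hsmooth.of_le (WithTop.coe_le_coe.2 le_top)
  have hHZ : H ⊆ {x ∈ V | h x = 1} := hH ▸ connectedComponentIn_subset _ _
  have hHconn : IsPreconnected H := hH ▸ isPreconnected_connectedComponentIn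
  have hUopen : IsOpen U := by
    rw [hU, hH]
    exact isOpen_cone_connectedComponentIn hVopen hVcone hk hsmooth.continuousOn hhomog hx₀V hx₀1
  have hHU : H ⊆ U := fun x hx ↦ hU ▸ ⟨1, one_pos, x, hx, by simp⟩
  have hUcone : ∀ l : ℝ, 0 < l → ∀ x ∈ U, l • x ∈ U := by
    rw [hU]
    rintro l hl _ ⟨l', hl', x, hx, rfl⟩
    exact ⟨l * l', mul_pos hl hl', x, hx, by rw [smul_smul]⟩
  have hUV : U ⊆ V := by
    rw [hU]
    rintro _ ⟨l, hl, x, hx, rfl⟩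
    exact hVcone l hl x (hHZ hx).1
  have hUpos : ∀ x ∈ U, 0 < h x := by
    rw [hU]
    rintro _ ⟨l, hl, x, hx, rfl⟩
    rw [hhomog l hl x (hHZ hx).1, (hHZ hx).2]
    positivity
  obtain ⟨hpV, hp1⟩ := hHZ hp
  have hm : 0 < k - ε := by linarith
  set D := fderiv ℝ h p with hD
  have hDp : D p = k := by
    rw [hD, fderiv_apply_self_of_homogeneous_s6 hhomog hpV ((hsmooth2.contDiffAt
      (hVopen.mem_nhds hpV)).differentiableAt (by simp)), hp1, mul_one]
  have hslice : {x | D (x - p) = 0} = {x | D x = k} := by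
    ext x
    simp [hDp, sub_eq_zero]
  set A := U ∩ {x | D (x - p) = 0} with hA
  have hpA : p ∈ A := ⟨hHU hp, by simp⟩
  have hlt : ∀ y ∈ A, y ≠ p → h y < 1 := fun y hy hyp ↦
    lt_of_concaveOn_rpow hVopen hsmooth2 (one_div_pos.2 hm) (fun x hx ↦ hUV hx.1)
      (fun x hx ↦ hUpos x hx.1) hpA hp1 (fun x hx ↦ hx.2) (hhyp p hp) hconc hy hyp
  have hAbdd : Bornology.IsBounded A := by
    refine ConcaveOn.isBounded_of_strict_max (D := D) (p := p) hconc
      (fun x hx ↦ Real.rpow_nonneg (hUpos x hx.1).le _) hpA (fun x hx ↦ hx.2)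
      ((hsmooth.continuousOn.mono fun x hx ↦ hUV hx.1).rpow_const fun x hx ↦
        Or.inl (hUpos x hx.1).ne') (fun x hx hxp ↦ ?_) ?_
    · exact Real.rpow_lt_rpow (hUpos x hx.1).le (by rw [hp1]; exact hlt x hx hxp)
        (one_div_pos.2 hm)
    · obtain ⟨r, hr, hball⟩ := Metric.nhds_basis_closedBall.mem_iff.1 (hUopen.mem_nhds (hHU hp))
      exact ⟨r, hr, fun x hx hx' ↦ ⟨hball hx, hx'⟩⟩
  have hDpos : ∀ x ∈ H, 0 < D x := by
    intro x hx
    by_contra! hneg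
    obtain ⟨z, hz, hDz⟩ : k / 2 ∈ D '' H :=
      (hHconn.image _ D.continuous.continuousOn).ordConnected.out ⟨x, hx, rfl⟩ ⟨p, hp, rfl⟩
        ⟨by linarith, by rw [hDp]; linarith⟩
    have h2 : (2 : ℝ) • z ∈ A := by
      rw [hA, hslice]
      refine ⟨hUcone 2 two_pos z (hHU hz), ?_⟩
      simp only [Set.mem_ofPred_eq, map_smul, smul_eq_mul, hDz]
      ring
    have h3 : 1 < h ((2 : ℝ) • z) := by
      rw [hhomog 2 two_pos z (hHZ hz).1, (hHZ hz).2, mul_one]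
      exact Real.one_lt_rpow one_lt_two hk
    by_cases h4 : (2 : ℝ) • z = p
    · rw [h4, hp1] at h3
      exact lt_irrefl _ h3
    · exact (hlt _ h2 h4).not_gt h3
  have hcompact : ∀ L : ℝ, IsCompact (H ∩ {x | D x ≤ L}) := by
    intro L
    refine Metric.isCompact_of_isClosed_isBounded
      (hHclosed.inter (isClosed_le D.continuous continuous_const)) ?_
    obtain ⟨R, hR⟩ := hAbdd.exists_norm_le
    refine isBounded_iff_forall_norm_le.2 ⟨L / k * R, fun x hx ↦ ?_⟩
    have hDx := hDpos x hx.1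
    have hy : (k / D x) • x ∈ A := by
      rw [hA, hslice]
      refine ⟨hUcone _ (by positivity) x (hHU hx.1), ?_⟩
      simp [hDx.ne']
    have h1 := hR _ hy
    rw [norm_smul, Real.norm_of_nonneg (by positivity)] at h1
    have hR0 : 0 ≤ R := le_trans (by positivity) h1
    calc ‖x‖ = D x / k * (k / D x * ‖x‖) := by field_simp
      _ ≤ L / k * R := by
        have : D x ≤ L := hx.2
        have hL : 0 ≤ L := hDx.le.trans this
        gcongr
  intro T hT γ hγ hγH hγK
  set S := {t : ℝ | 0 ≤ t ∧ ENNReal.ofReal t < T}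
  by_contra hfin
  have hIcc : ∀ b ∈ S, Icc 0 b ⊆ S := fun b hb t ht ↦
    ⟨ht.1, (ENNReal.ofReal_le_ofReal ht.2).trans_lt hb.2⟩
  set κ := Real.sqrt (k / (k - ε) - 1) with hκ
  have hκ2 : 0 < k / (k - ε) - 1 := by
    rw [sub_pos, one_lt_div hm]
    linarith
  have hκpos : 0 < κ := Real.sqrt_pos.2 hκ2
  have hγS : ∀ t ∈ S, γ t ∈ H := fun t ht ↦ hγH t ht.1 ht.2
  obtain ⟨B, hbound⟩ : ∃ B, ∀ b ∈ S, |Real.log (D (γ b)) - Real.log (D (γ 0))| ≤ B := by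
    refine exists_abs_sub_le_of_mul_abs_deriv_le (θ := fun t ↦ Real.log (D (γ t))) hκpos
      (fun b hb ↦ ⟨hb.1, hIcc b hb⟩) ?_ ?_ hfin
    · exact (D.contDiff.comp_contDiffOn (hγ.of_le (WithTop.coe_le_coe.2 le_top))).log
        fun t ht ↦ (hDpos _ (hγS t ht)).ne'
    · intro t hSt
      have htS := mem_of_mem_nhds hSt
      have hγt : HasDerivAt γ (derivWithin γ S t) t :=
        ((hγ.differentiableOn (by simp)) t htS).hasDerivWithinAt.hasDerivAt hSt
      have hx := hγS t htS
      have hDx := hDpos _ hx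
      have htan : fderiv ℝ h (γ t) (derivWithin γ S t) = 0 := by
        have hdh := ((hsmooth2.contDiffAt (hVopen.mem_nhds (hHZ hx).1)).differentiableAt
          (by simp)).hasFDerivAt.comp_hasDerivAt t hγt
        refine hdh.unique ((hasDerivAt_const t (1 : ℝ)).congr_of_eventuallyEq ?_)
        filter_upwards [hSt] with s hs using (hHZ (hγS s hs)).2
      have hθ : deriv (fun t ↦ Real.log (D (γ t))) t = D (derivWithin γ S t) / D (γ t) :=
        ((D.hasFDerivAt.comp_hasDerivAt t hγt).log hDx.ne').deriv
      rw [hθ, hκ, ← Real.sqrt_sq_eq_abs, ← Real.sqrt_mul hκ2.le]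
      exact Real.sqrt_le_sqrt (centroaffine_metric_lower_bound hVopen hsmooth2 hhomog hUopen hUV hk
        hUcone hUpos hm (by rw [← hslice]; exact hconc) (hHU hx) (hHZ hx).2 hDx htan)
  refine hγK ⟨_, hcompact (Real.exp (Real.log (D (γ 0)) + B)), inter_subset_left, ?_⟩
  rintro _ ⟨b, hb, rfl⟩
  refine ⟨hγS b hb, ?_⟩
  have h1 := (abs_le.1 (hbound b hb)).2
  rw [sub_le_iff_le_add'] at h1
  exact (Real.log_le_iff_le_exp (hDpos _ (hγS b hb))).1 h1
end

section
/- Let h be a homogeneous cubic polynomial on ℝ^{n+1} and let H ⊆ {x ∈ ℝ^{n+1} : h(x) = 1} be a nonempty smooth hypersurface such that the Hessian D²h_p is negative definite on ker Dh_p for every p ∈ H (i.e., H is a projective special real manifold). Then H is a closed subset of ℝ^{n+1} if and only if for every T ∈ (0, ∞] every smooth curve γ : [0, T) → H that is not contained in any compact subset of H has infinite centroaffine length ∫₀^T √(−(1/3)·D²h_{γ(t)}(γ'(t), γ'(t))) dt = ∞. -/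
open Set MeasureTheory ENNReal Filter Topology

section CubicForm

variable {E : Type*} [NormedAddCommGroup E] [NormedSpace ℝ E]

/-- A smooth function which is homogeneous of degree three and cubic along every line. -/
structure IsCubicForm (h : E → ℝ) : Prop where
  contDiff : ContDiff ℝ (⊤ : ℕ∞) h
  map_smul : ∀ (s : ℝ) x, h (s • x) = s ^ 3 * h x
  cubic : ∀ x v, ∃ a b c : ℝ, ∀ t : ℝ, h (x + t • v) = h x + t * a + t ^ 2 * b + t ^ 3 * c

lemma isCubicForm_eval {ι : Type*} [Fintype ι] (P : MvPolynomial ι ℝ) (hP : P.IsHomogeneous 3)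
    (h : EuclideanSpace ℝ ι → ℝ) (hh : ∀ x, h x = MvPolynomial.eval (fun i => x i) P) :
    IsCubicForm h where
  contDiff := by
    obtain rfl : h = fun x => MvPolynomial.eval (fun i => x i) P := funext hh
    simp only [MvPolynomial.eval_eq]
    fun_prop
  map_smul s x := by
    rw [hh, hh, MvPolynomial.eval_eq, MvPolynomial.eval_eq, Finset.mul_sum]
    refine Finset.sum_congr rfl fun d hd => ?_
    have hdeg : ∑ i ∈ d.support, d i = 3 := by
      simpa [Finsupp.weight_apply, Finsupp.sum] using hP (MvPolynomial.mem_support_iff.1 hd)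
    simp only [PiLp.smul_apply, smul_eq_mul, mul_pow, Finset.prod_mul_distrib,
      Finset.prod_pow_eq_pow_sum, hdeg]
    ring
  cubic x v := by
    set p : Polynomial ℝ := MvPolynomial.aeval
      (fun i => Polynomial.C (x i) + Polynomial.X * Polynomial.C (v i)) P with hp
    have hdeg : p.natDegree < 4 := by
      have := MvPolynomial.aeval_natDegree_le P hP.totalDegree_le
        (fun i => Polynomial.C (x i) + Polynomial.X * Polynomial.C (v i)) (n := 1)
        (fun i => by compute_degree)
      rw [hp]
      omega
    have heval (t : ℝ) : h (x + t • v) = p.eval t := by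
      rw [hh, hp, ← Polynomial.coe_aeval_eq_eval, ← AlgHom.comp_apply, MvPolynomial.comp_aeval,
        ← MvPolynomial.coe_aeval_eq_eval]
      simp [MvPolynomial.aeval_def, mul_comm t]
    refine ⟨p.coeff 1, p.coeff 2, p.coeff 3, fun t => ?_⟩
    have h0 : h x = p.coeff 0 := by
      have := heval 0
      rwa [zero_smul, add_zero, ← Polynomial.coeff_zero_eq_eval_zero] at this
    rw [heval, Polynomial.eval_eq_sum_range' hdeg, h0]
    simp only [Finset.sum_range_succ, Finset.sum_range_zero]
    ring

namespace IsCubicForm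

variable {h : E → ℝ}

lemma continuous (hq : IsCubicForm h) : Continuous h := hq.contDiff.continuous

lemma ne_zero_of_pos (hq : IsCubicForm h) {x : E} (hx : 0 < h x) : x ≠ 0 := by
  rintro rfl
  have := hq.map_smul 0 0
  norm_num at this
  exact hx.ne' this

lemma differentiable (hq : IsCubicForm h) : Differentiable ℝ h :=
  hq.contDiff.differentiable (by simp)

lemma contDiff_fderiv (hq : IsCubicForm h) : ContDiff ℝ (⊤ : ℕ∞) (fderiv ℝ h) :=
  hq.contDiff.fderiv_right (by simp)

lemma taylor (hq : IsCubicForm h) (x v : E) : ∃ c : ℝ, ∀ t : ℝ,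
    h (x + t • v) = h x + t * fderiv ℝ h x v + t ^ 2 / 2 * fderiv ℝ (fderiv ℝ h) x v v
      + t ^ 3 * c := by
  obtain ⟨a, b, c, H⟩ := hq.cubic x v
  have hline (t : ℝ) : HasDerivAt (fun t : ℝ => x + t • v) v t := by
    simpa using ((hasDerivAt_id t).smul_const v).const_add x
  have h1 (t : ℝ) : fderiv ℝ h (x + t • v) v = a + t * (2 * b) + t ^ 2 * (3 * c) := by
    have e1 := (hq.differentiable (x + t • v)).hasFDerivAt.comp_hasDerivAt t (hline t)
    have e2 : HasDerivAt (fun t : ℝ => h x + t * a + t ^ 2 * b + t ^ 3 * c)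
        (a + t * (2 * b) + t ^ 2 * (3 * c)) t := by
      refine (((hasDerivAt_mul_const a).const_add (h x)).fun_add
        ((hasDerivAt_pow 2 t).mul_const b)).fun_add ((hasDerivAt_pow 3 t).mul_const c)
        |>.congr_deriv ?_
      norm_num
      ring
    rw [show h ∘ (fun t : ℝ => x + t • v) = _ from funext H] at e1
    exact e1.unique e2
  have h2 : fderiv ℝ (fderiv ℝ h) x v v = 2 * b := by
    have e0 : HasFDerivAt (fderiv ℝ h) (fderiv ℝ (fderiv ℝ h) x) (x + (0 : ℝ) • v) := by
      rw [zero_smul, add_zero]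
      exact (hq.contDiff_fderiv.differentiable (by simp) x).hasFDerivAt
    have e1 : HasDerivAt (fun t : ℝ => fderiv ℝ h (x + t • v) v)
        (fderiv ℝ (fderiv ℝ h) x v v) 0 :=
      (ContinuousLinearMap.apply ℝ ℝ v).hasFDerivAt.comp_hasDerivAt (0 : ℝ)
        (e0.comp_hasDerivAt (0 : ℝ) (hline 0))
    have e2 : HasDerivAt (fun t : ℝ => a + t * (2 * b) + t ^ 2 * (3 * c)) (2 * b) 0 := by
      refine ((hasDerivAt_mul_const (2 * b)).const_add a).fun_add
        ((hasDerivAt_pow 2 0).mul_const (3 * c)) |>.congr_deriv ?_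
      simp
    simp only [h1] at e1
    exact e1.unique e2
  have h1' : fderiv ℝ h x v = a := by simpa using h1 0
  refine ⟨c, fun t => ?_⟩
  rw [H, h2, h1']
  ring

lemma fderiv_smul (hq : IsCubicForm h) {s : ℝ} (hs : s ≠ 0) (x v : E) :
    fderiv ℝ h (s • x) v = s ^ 2 * fderiv ℝ h x v ∧
      fderiv ℝ (fderiv ℝ h) (s • x) v v = s * fderiv ℝ (fderiv ℝ h) x v v := by
  obtain ⟨c, hc⟩ := hq.taylor x v
  obtain ⟨d, hd⟩ := hq.taylor (s • x) v
  have key (t : ℝ) : s ^ 3 * (t * fderiv ℝ h x v + t ^ 2 / 2 * fderiv ℝ (fderiv ℝ h) x v v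
      + t ^ 3 * c) = s * t * fderiv ℝ h (s • x) v
      + (s * t) ^ 2 / 2 * fderiv ℝ (fderiv ℝ h) (s • x) v v + (s * t) ^ 3 * d := by
    have e1 := hd (s * t)
    rw [mul_smul, ← smul_add, hq.map_smul, hc t, hq.map_smul] at e1
    linear_combination e1
  have k1 := key 1
  have k2 := key (-1)
  have k3 := key 2
  constructor
  · refine mul_left_cancel₀ hs ?_
    linear_combination -k1 + k2 / 3 + k3 / 6
  · refine mul_left_cancel₀ (pow_ne_zero 2 hs) ?_
    linear_combination -k1 - k2

end IsCubicForm

lemma nonneg_of_cubic_nonneg {a b c : ℝ}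
    (H : ∀ᶠ t : ℝ in 𝓝[>] 0, 0 ≤ t * a + t ^ 2 / 2 * b + t ^ 3 * c) :
    0 ≤ a ∧ (a = 0 → 0 ≤ b) := by
  have hpos : ∀ᶠ t : ℝ in 𝓝[>] 0, 0 < t := eventually_mem_nhdsWithin
  constructor
  · have hlim : Tendsto (fun t : ℝ => a + t / 2 * b + t ^ 2 * c) (𝓝[>] 0) (𝓝 a) := by
      have : Continuous fun t : ℝ => a + t / 2 * b + t ^ 2 * c := by fun_prop
      simpa using (this.tendsto 0).mono_left nhdsWithin_le_nhds
    refine ge_of_tendsto hlim ?_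
    filter_upwards [H, hpos] with t ht h0
    refine nonneg_of_mul_nonneg_right (a := t) ?_ h0
    linarith
  · rintro rfl
    have hlim : Tendsto (fun t : ℝ => b + 2 * t * c) (𝓝[>] 0) (𝓝 b) := by
      have : Continuous fun t : ℝ => b + 2 * t * c := by fun_prop
      simpa using (this.tendsto 0).mono_left nhdsWithin_le_nhds
    refine ge_of_tendsto hlim ?_
    filter_upwards [H, hpos] with t ht h0
    refine nonneg_of_mul_nonneg_right (a := t ^ 2) ?_ (by positivity)
    linarith

/-- At every point of `U`, the Hessian of `h` is negative definite on the kernel of its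
differential. -/
def HessianNegOn (h : E → ℝ) (U : Set E) : Prop :=
  ∀ x ∈ U, ∀ v, fderiv ℝ h x v = 0 → v ≠ 0 → fderiv ℝ (fderiv ℝ h) x v v < 0

lemma HessianNegOn.min_le {h : E → ℝ} {U : Set E} (hU : HessianNegOn h U) (hq : IsCubicForm h)
    {x v : E} (hseg : ∀ t ∈ Icc (0 : ℝ) 1, x + t • v ∈ U) {t : ℝ} (ht : t ∈ Icc (0 : ℝ) 1) :
    min (h x) (h (x + v)) ≤ h (x + t • v) := by
  rcases eq_or_ne v 0 with rfl | hv
  · simp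
  have hcont : Continuous fun t : ℝ => h (x + t • v) := hq.continuous.comp (by fun_prop)
  obtain ⟨m, hm, hmin⟩ := isCompact_Icc.exists_isMinOn (nonempty_Icc.2 zero_le_one)
    hcont.continuousOn
  refine le_trans ?_ (hmin ht)
  rcases hm.1.eq_or_lt with rfl | h0
  · simp
  rcases hm.2.eq_or_lt with rfl | h1
  · simp
  exfalso
  obtain ⟨c, hc⟩ := hq.taylor (x + m • v) v
  have hnear : ∀ᶠ s : ℝ in 𝓝 0, h (x + m • v) ≤ h (x + m • v + s • v) := by
    have : Tendsto (fun s : ℝ => m + s) (𝓝 0) (𝓝 m) := by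
      have : Continuous fun s : ℝ => m + s := by fun_prop
      simpa using this.tendsto 0
    filter_upwards [this (Icc_mem_nhds h0 h1)] with s hs
    have := hmin hs
    simpa only [mem_ofPred_eq, add_smul, ← add_assoc] using this
  have hneg : ∀ᶠ s : ℝ in 𝓝 0, h (x + m • v) ≤ h (x + m • v + (-s) • v) := by
    have : Tendsto (fun s : ℝ => -s) (𝓝 0) (𝓝 0) := by
      simpa using (continuous_neg (G := ℝ)).tendsto 0
    exact this.eventually hnear
  have A := nonneg_of_cubic_nonneg (a := fderiv ℝ h (x + m • v) v)
    (b := fderiv ℝ (fderiv ℝ h) (x + m • v) v v) (c := c) (by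
      filter_upwards [nhdsWithin_le_nhds hnear] with s hs
      rw [hc] at hs
      linarith)
  have B := nonneg_of_cubic_nonneg (a := -fderiv ℝ h (x + m • v) v)
    (b := fderiv ℝ (fderiv ℝ h) (x + m • v) v v) (c := -c) (by
      filter_upwards [nhdsWithin_le_nhds hneg] with s hs
      rw [hc] at hs
      linarith)
  have hz : fderiv ℝ h (x + m • v) v = 0 := by linarith [A.1, B.1]
  exact absurd (A.2 hz) (not_le.2 (hU _ (hseg m hm) v hz hv))

/-- An open convex cone on which the cubic form `h` is positive, whose frontier does not meet
`{h > 0}`, and on which `h` has negative definite Hessian along the level sets. -/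
structure IsHyperbolicCone (h : E → ℝ) (C : Set E) : Prop where
  isOpen : IsOpen C
  convex : Convex ℝ C
  pos : ∀ x ∈ C, 0 < h x
  smul_mem : ∀ x ∈ C, ∀ s : ℝ, 0 < s → s • x ∈ C
  mem_of_closure : ∀ x ∈ closure C, 0 < h x → x ∈ C
  hessianNegOn : HessianNegOn h C

namespace IsHyperbolicCone

variable {h : E → ℝ} {C : Set E}

lemma le_add (hC : IsHyperbolicCone h C) (hq : IsCubicForm h) {p y : E} (hp : p ∈ C) (hy : y ∈ C) :
    h p ≤ h (p + y) := by
  have hlarge : ∃ s : ℝ, 1 ≤ s ∧ h p ≤ h (p + s • y) := by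
    have hlim : Tendsto (fun s : ℝ => h (s⁻¹ • p + y)) atTop (𝓝 (h y)) := by
      have hc : Continuous fun r : ℝ => h (r • p + y) := hq.continuous.comp (by fun_prop)
      simpa [Function.comp_def] using (hc.tendsto 0).comp tendsto_inv_atTop_zero
    have hinf : Tendsto (fun s : ℝ => s ^ 3 * h (s⁻¹ • p + y)) atTop atTop :=
      (tendsto_pow_atTop (by norm_num)).atTop_mul_pos (hC.pos y hy) hlim
    obtain ⟨s, h1, hs⟩ := ((eventually_ge_atTop (1 : ℝ)).and
      (hinf.eventually_ge_atTop (h p))).exists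
    refine ⟨s, h1, hs.trans_eq ?_⟩
    rw [← hq.map_smul, smul_add, smul_inv_smul₀ (by positivity)]
  obtain ⟨s, h1, hs⟩ := hlarge
  have hs0 : 0 < s := by positivity
  have hadd : ∀ r : ℝ, 0 ≤ r → p + r • y ∈ C := by
    intro r hr
    rcases hr.eq_or_lt with rfl | hr
    · simpa using hp
    have := hC.smul_mem _ (hC.convex hp (hC.smul_mem y hy r hr) (a := 1 / 2) (b := 1 / 2)
      (by norm_num) (by norm_num) (by norm_num)) 2 (by norm_num)
    rwa [← smul_add, smul_smul, mul_one_div_cancel two_ne_zero, one_smul] at this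
  have := hC.hessianNegOn.min_le hq (x := p) (v := s • y) (fun t ht => by
    rw [smul_smul]
    exact hadd _ (mul_nonneg ht.1 hs0.le)) (t := s⁻¹) ⟨by positivity, inv_le_one_of_one_le₀ h1⟩
  rwa [min_eq_left hs, inv_smul_smul₀ hs0.ne'] at this

lemma fderiv_pos (hC : IsHyperbolicCone h C) (hq : IsCubicForm h) {p y : E} (hp : p ∈ C)
    (hy : y ∈ closure C) (hy0 : y ≠ 0) : 0 < fderiv ℝ h p y := by
  have hle : ∀ t : ℝ, 0 < t → h p ≤ h (p + t • y) := by
    intro t ht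
    have hcl : IsClosed {y | h p ≤ h (p + t • y)} :=
      isClosed_le continuous_const (hq.continuous.comp (by fun_prop))
    exact closure_minimal (fun z hz => hC.le_add hq hp (hC.smul_mem z hz t ht)) hcl hy
  obtain ⟨c, hc⟩ := hq.taylor p y
  have A := nonneg_of_cubic_nonneg (a := fderiv ℝ h p y)
    (b := fderiv ℝ (fderiv ℝ h) p y y) (c := c) (by
      filter_upwards [eventually_mem_nhdsWithin] with s hs
      have := hle s hs
      rw [hc] at this
      linarith)
  refine A.1.lt_of_ne fun h0 => ?_
  exact absurd (A.2 h0.symm) (not_le.2 (hC.hessianNegOn p hp y h0.symm hy0))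

lemma exists_exit (hC : IsHyperbolicCone h C) (hq : IsCubicForm h) {x v : E} (hx : x ∈ C)
    (hv : fderiv ℝ h x v = 0) (hv0 : v ≠ 0) :
    ∃ t : ℝ, 0 < t ∧ h (x + t • v) = 0 ∧ ∀ s, 0 ≤ s → s < t → x + s • v ∈ C := by
  have hline : Continuous fun t : ℝ => x + t • v := by fun_prop
  set S : Set ℝ := {t | 0 ≤ t ∧ x + t • v ∉ C} with hS
  have hScl : IsClosed S := isClosed_Ici.inter (hC.isOpen.isClosed_compl.preimage hline)
  have hSbdd : BddBelow S := ⟨0, fun t ht => ht.1⟩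
  have hSne : S.Nonempty := by
    by_contra hempty
    have hall : ∀ t : ℝ, 0 < t → x + t • v ∈ C := by
      intro t ht
      by_contra hn
      exact hempty ⟨t, ht.le, hn⟩
    have hlim : Tendsto (fun s : ℝ => s⁻¹ • x + v) atTop (𝓝 v) := by
      have hc : Continuous fun r : ℝ => r • x + v := by fun_prop
      simpa [Function.comp_def] using (hc.tendsto 0).comp tendsto_inv_atTop_zero
    have hvC : v ∈ closure C := by
      refine mem_closure_of_tendsto hlim ?_
      filter_upwards [eventually_gt_atTop 0] with s hs
      have := hC.smul_mem _ (hall s hs) s⁻¹ (by positivity)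
      rwa [smul_add, inv_smul_smul₀ hs.ne'] at this
    exact (hC.fderiv_pos hq hx hvC hv0).ne' hv
  have hmem : sInf S ∈ S := hScl.csInf_mem hSne hSbdd
  have hpos : 0 < sInf S := by
    refine hmem.1.lt_of_ne fun h0 => hmem.2 ?_
    rw [← h0]
    simpa using hx
  have hlt : ∀ s, 0 ≤ s → s < sInf S → x + s • v ∈ C := by
    intro s hs hs'
    by_contra hn
    exact notMem_of_lt_csInf hs' hSbdd ⟨hs, hn⟩
  have hcl : x + sInf S • v ∈ closure C := by
    refine mem_closure_of_tendsto ((hline.tendsto (sInf S)).mono_left nhdsWithin_le_nhds)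
      (b := 𝓝[<] sInf S) ?_
    filter_upwards [eventually_mem_nhdsWithin, nhdsWithin_le_nhds (Ioi_mem_nhds hpos)] with s h1 h2
    exact hlt s (le_of_lt h2) h1
  refine ⟨sInf S, hpos, le_antisymm ?_ ?_, hlt⟩
  · by_contra! hn
    exact hmem.2 (hC.mem_of_closure _ hcl hn)
  · exact closure_minimal (fun z hz => (hC.pos z hz).le)
      (isClosed_le continuous_const hq.continuous) hcl

lemma three_quarters_le {a c t u : ℝ} (ht : 0 < t) (hu : 0 < u)
    (h1 : 1 - a * t ^ 2 + c * t ^ 3 = 0) (h2 : 1 - a * u ^ 2 - c * u ^ 3 = 0) :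
    3 / 4 ≤ a * t ^ 2 := by
  have h3 : (t + u) * (a * t ^ 2 * u ^ 2) = (t + u) * (t ^ 2 - t * u + u ^ 2) := by
    linear_combination -u ^ 3 * h1 - t ^ 3 * h2
  have h4 := mul_left_cancel₀ (by positivity) h3
  have h5 : (3 / 4) * u ^ 2 ≤ a * t ^ 2 * u ^ 2 := by
    rw [h4]
    nlinarith [sq_nonneg (t - u / 2)]
  exact le_of_mul_le_mul_right h5 (by positivity)

lemma mem_of_sq_mul_lt (hC : IsHyperbolicCone h C) (hq : IsCubicForm h) {x v : E} (hx : x ∈ C)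
    (hx1 : h x = 1) (hv : fderiv ℝ h x v = 0) (hv0 : v ≠ 0) {s : ℝ} (hs : 0 ≤ s)
    (hlt : -fderiv ℝ (fderiv ℝ h) x v v * s ^ 2 < 3 / 2) : x + s • v ∈ C := by
  obtain ⟨t, ht, htz, htC⟩ := hC.exists_exit hq hx hv hv0
  obtain ⟨u, hu, huz, -⟩ := hC.exists_exit hq hx (v := -v) (by simp [hv]) (neg_ne_zero.2 hv0)
  refine htC s hs ?_
  obtain ⟨c, hc⟩ := hq.taylor x v
  have e1 := hc t
  have e2 := hc (-u)
  rw [neg_smul, ← smul_neg, huz] at e2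
  rw [htz] at e1
  rw [hx1, hv] at e1 e2
  have key := three_quarters_le (a := -fderiv ℝ (fderiv ℝ h) x v v / 2) (c := c) ht hu
    (by linarith) (by linarith)
  by_contra! hts
  have hneg := hC.hessianNegOn x hx v hv hv0
  have : t ^ 2 ≤ s ^ 2 := by gcongr
  nlinarith

lemma abs_fderiv_le (hC : IsHyperbolicCone h C) (hq : IsCubicForm h) {p x v : E} (hp : p ∈ C)
    (hx : x ∈ C) (hx1 : h x = 1) (hv : fderiv ℝ h x v = 0) :
    |fderiv ℝ h p v| ≤ √(-fderiv ℝ (fderiv ℝ h) x v v) * fderiv ℝ h p x := by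
  rcases eq_or_ne v 0 with rfl | hv0
  · simp
  have hneg := hC.hessianNegOn x hx v hv hv0
  set N := √(-fderiv ℝ (fderiv ℝ h) x v v) with hN
  have hN0 : 0 < N := Real.sqrt_pos.2 (by linarith)
  have hN2 : N ^ 2 = -fderiv ℝ (fderiv ℝ h) x v v := Real.sq_sqrt (by linarith)
  have hbound : ∀ w : E, w ≠ 0 → fderiv ℝ h x w = 0 →
      fderiv ℝ (fderiv ℝ h) x w w = fderiv ℝ (fderiv ℝ h) x v v →
      -fderiv ℝ h p w ≤ N * fderiv ℝ h p x := by
    intro w hw hxw hww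
    have hmem : x + N⁻¹ • w ∈ C := by
      refine hC.mem_of_sq_mul_lt hq hx hx1 hxw hw (by positivity) ?_
      rw [hww, ← hN2, ← mul_pow, mul_inv_cancel₀ hN0.ne']
      norm_num
    have := hC.fderiv_pos hq hp (subset_closure hmem) (hq.ne_zero_of_pos (hC.pos _ hmem))
    rw [map_add, _root_.map_smul, smul_eq_mul] at this
    have h2 := mul_pos hN0 this
    rw [mul_add, mul_inv_cancel_left₀ hN0.ne'] at h2
    linarith
  refine abs_le'.2 ⟨?_, hbound v hv0 hv rfl⟩
  simpa using hbound (-v) (neg_ne_zero.2 hv0) (by simp [hv]) (by simp)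

/-- A linear form that is positive on the closed cone controls the norm. -/
lemma exists_norm_le [FiniteDimensional ℝ E] (hC : IsHyperbolicCone h C) (hq : IsCubicForm h)
    {p : E} (hp : p ∈ C) : ∃ c : ℝ, ∀ x ∈ C, ‖x‖ ≤ c * fderiv ℝ h p x := by
  have hK : IsCompact (Metric.sphere (0 : E) 1 ∩ closure C) :=
    (isCompact_sphere 0 1).inter_right isClosed_closure
  have hnormal : ∀ x ∈ C, x ≠ 0 → ‖x‖⁻¹ • x ∈ Metric.sphere (0 : E) 1 ∩ closure C := by
    intro x hx hx0
    refine ⟨?_, subset_closure (hC.smul_mem x hx _ (by positivity))⟩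
    simp [norm_smul, hx0]
  rcases (Metric.sphere (0 : E) 1 ∩ closure C).eq_empty_or_nonempty with hempty | hne
  · refine ⟨0, fun x hx => ?_⟩
    rcases eq_or_ne x 0 with rfl | hx0
    · simp
    · exact absurd (hnormal x hx hx0) (by simp [hempty])
  obtain ⟨m, hm, hmin⟩ := hK.exists_isMinOn hne (fderiv ℝ h p).continuous.continuousOn
  have hmpos : 0 < fderiv ℝ h p m := hC.fderiv_pos hq hp hm.2 (by
    rintro rfl
    simpa using hm.1)
  refine ⟨(fderiv ℝ h p m)⁻¹, fun x hx => ?_⟩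
  rcases eq_or_ne x 0 with rfl | hx0
  · simp
  have := hmin (hnormal x hx hx0)
  rw [mem_ofPred_eq, _root_.map_smul, smul_eq_mul] at this
  have hxn : 0 < ‖x‖ := norm_pos_iff.2 hx0
  rw [inv_mul_eq_div] at this ⊢
  rw [le_div_iff₀ hxn] at this
  rw [le_div_iff₀ hmpos]
  linarith

end IsHyperbolicCone

end CubicForm

section RadialProjection

variable {E : Type*} [NormedAddCommGroup E] [NormedSpace ℝ E] {h : E → ℝ}

/-- The radial projection of `{h > 0}` onto the level set `{h = 1}`. -/
noncomputable def radialProj (h : E → ℝ) (x : E) : E := h x ^ (-(1 / 3) : ℝ) • x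

lemma radialProj_of_eq_one {x : E} (hx : h x = 1) : radialProj h x = x := by
  simp [radialProj, hx]

namespace IsCubicForm

lemma map_radialProj (hq : IsCubicForm h) {x : E} (hx : 0 < h x) : h (radialProj h x) = 1 := by
  rw [radialProj, hq.map_smul, ← Real.rpow_natCast, ← Real.rpow_mul hx.le]
  norm_num
  rw [Real.rpow_neg_one, inv_mul_cancel₀ hx.ne']

lemma radialProj_smul (hq : IsCubicForm h) {x : E} (hx : 0 < h x) {s : ℝ} (hs : 0 < s) :
    radialProj h (s • x) = radialProj h x := by
  rw [radialProj, radialProj, hq.map_smul, Real.mul_rpow (by positivity) hx.le,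
    ← Real.rpow_natCast, ← Real.rpow_mul hs.le, smul_smul]
  norm_num
  rw [Real.rpow_neg_one, mul_right_comm, inv_mul_cancel₀ hs.ne', one_mul]

lemma contDiffAt_radialProj (hq : IsCubicForm h) {x : E} (hx : 0 < h x) :
    ContDiffAt ℝ (⊤ : ℕ∞) (radialProj h) x :=
  (hq.contDiff.contDiffAt.rpow_const_of_ne hx.ne').smul contDiffAt_id

end IsCubicForm

/-- The cone over a subset of the level set `{h = 1}`. -/
def coneOver (h : E → ℝ) (H : Set E) : Set E := {x | 0 < h x ∧ radialProj h x ∈ H}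

lemma isOpen_coneOver (hq : IsCubicForm h) {W : Set E} (hW : IsOpen W) :
    IsOpen (coneOver h (W ∩ {x | h x = 1})) := by
  rw [isOpen_iff_mem_nhds]
  intro x hx
  filter_upwards [hq.continuous.continuousAt.eventually (lt_mem_nhds hx.1),
    (hq.contDiffAt_radialProj hx.1).continuousAt.eventually (hW.mem_nhds hx.2.1)] with y h1 h2
  exact ⟨h1, h2, hq.map_radialProj h1⟩

lemma mem_coneOver_of_mem_closure (hq : IsCubicForm h) {H : Set E} (hH : IsClosed H) {x : E}
    (hx : x ∈ closure (coneOver h H)) (hpos : 0 < h x) : x ∈ coneOver h H := by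
  refine ⟨hpos, ?_⟩
  have := (hq.contDiffAt_radialProj hpos).continuousAt.continuousWithinAt.mem_closure_image hx
  exact closure_minimal (image_subset_iff.2 fun y hy => hy.2) hH this

lemma HessianNegOn.coneOver {H : Set E} (hH : HessianNegOn h H) (hq : IsCubicForm h) :
    HessianNegOn h (coneOver h H) := by
  intro x hx v hv hv0
  have hs : 0 < h x ^ (-(1 / 3) : ℝ) := Real.rpow_pos_of_pos hx.1 _
  obtain ⟨h1, h2⟩ := hq.fderiv_smul hs.ne' x v
  have := hH _ hx.2 v (by rw [radialProj, h1, hv, mul_zero]) hv0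
  rw [radialProj, h2] at this
  by_contra! hn
  exact this.not_ge (mul_nonneg hs.le hn)

/-- Components of an open set on which the Hessian condition holds, and whose frontier does not
meet `{h > 0}`, are convex. -/
lemma convex_connectedComponentIn (hq : IsCubicForm h) {U : Set E} (hU : IsOpen U)
    (hpos : ∀ x ∈ U, 0 < h x) (hcl : ∀ x ∈ closure U, 0 < h x → x ∈ U) (hneg : HessianNegOn h U)
    (p : E) : Convex ℝ (connectedComponentIn U p) := by
  rw [convex_iff_segment_subset]
  intro x hx y hy
  have hsub := connectedComponentIn_subset U p
  set V : Set E := {y | ∀ t ∈ Icc (0 : ℝ) 1, x + t • (y - x) ∈ U} with hV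
  have hVopen : IsOpen V := by
    rw [isOpen_iff_mem_nhds]
    intro z hz
    refine isCompact_Icc.eventually_forall_of_forall_eventually fun t ht => ?_
    have hc : Continuous fun q : E × ℝ => x + q.2 • (q.1 - x) := by fun_prop
    exact hc.continuousAt.eventually (hU.mem_nhds (hz t ht))
  have hxV : x ∈ V := fun t _ => by simpa using hsub hx
  have hcomp : connectedComponentIn U p ⊆ V := by
    refine isPreconnected_connectedComponentIn.subset_of_closure_inter_subset hVopen
      ⟨x, hx, hxV⟩ ?_
    rintro z ⟨hzV, hzU⟩ t ht
    have hc : Continuous fun z : E => x + t • (z - x) := by fun_prop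
    refine hcl _ (map_mem_closure (f := fun z : E => x + t • (z - x)) hc hzV fun w hw => hw t ht) ?_
    have hle : z ∈ {z | min (h x) (h z) ≤ h (x + t • (z - x))} := by
      refine closure_minimal (fun w hw => ?_) (isClosed_le
        (continuous_const.min hq.continuous) (hq.continuous.comp hc)) hzV
      simpa using hneg.min_le hq hw ht
    exact (lt_min (hpos x (hsub hx)) (hpos z (hsub hzU))).trans_le hle
  have hseg : segment ℝ x y ⊆ U := by
    rw [segment_eq_image']
    rintro _ ⟨t, ht, rfl⟩
    exact hcomp hy t ht
  have := (convex_segment x y).isPreconnected.subset_connectedComponentIn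
    (left_mem_segment ℝ x y) hseg
  rwa [connectedComponentIn_eq hx]

/-- The component of the cone over a closed hyperbolic hypersurface is a hyperbolic cone. -/
lemma isHyperbolicCone_connectedComponentIn (hq : IsCubicForm h) {H W : Set E} (hW : IsOpen W)
    (hHW : H = W ∩ {x | h x = 1}) (hneg : HessianNegOn h H) (hH : IsClosed H) (p : E) :
    IsHyperbolicCone h (connectedComponentIn (coneOver h H) p) := by
  have hsub := connectedComponentIn_subset (coneOver h H) p
  have hopen : IsOpen (coneOver h H) := by
    rw [hHW]
    exact isOpen_coneOver hq hW
  refine ⟨hopen.connectedComponentIn, ?_, fun x hx => (hsub hx).1, ?_, ?_, ?_⟩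
  · exact convex_connectedComponentIn hq hopen (fun x hx => hx.1)
      (fun x hx => mem_coneOver_of_mem_closure hq hH hx) (hneg.coneOver hq) p
  · intro x hx s hs
    have hray : IsPreconnected ((fun r : ℝ => r • x) '' Ioi 0) :=
      isPreconnected_Ioi.image _ (by fun_prop)
    have := hray.subset_connectedComponentIn (x := x) (F := coneOver h H) ⟨1, by simp, by simp⟩ (by
      rintro _ ⟨r, hr, rfl⟩
      have hr : 0 < r := hr
      refine ⟨?_, ?_⟩
      · rw [hq.map_smul]
        have := (hsub hx).1
        positivity
      · rw [hq.radialProj_smul (hsub hx).1 hr]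
        exact (hsub hx).2)
    rw [connectedComponentIn_eq hx]
    exact this ⟨s, hs, rfl⟩
  · intro x hx hpos
    have hxU := mem_coneOver_of_mem_closure hq hH (closure_mono hsub hx) hpos
    have hne : (connectedComponentIn (coneOver h H) p).Nonempty := closure_nonempty_iff.1 ⟨x, hx⟩
    have hpU := connectedComponentIn_nonempty_iff.1 hne
    have hpre : IsPreconnected (insert x (connectedComponentIn (coneOver h H) p)) :=
      isPreconnected_connectedComponentIn.subset_closure (subset_insert _ _)
        (insert_subset hx subset_closure)
    exact hpre.subset_connectedComponentIn (mem_insert_of_mem _ (mem_connectedComponentIn hpU))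
      (insert_subset hxU hsub) (mem_insert _ _)
  · exact fun x hx => hneg.coneOver hq x (hsub hx)

end RadialProjection

section Length

variable {E : Type*} [NormedAddCommGroup E] [NormedSpace ℝ E] {h : E → ℝ}

/-- Along a curve in the level set `{h = 1}` of a hyperbolic cone, the logarithm of the linear form
`fderiv ℝ h p` grows at most by a multiple of the centroaffine length. -/
lemma IsHyperbolicCone.ofReal_log_sub_le {C : Set E} (hC : IsHyperbolicCone h C)
    (hq : IsCubicForm h) {p : E} (hp : p ∈ C) {I : Set ℝ} (hI : UniqueDiffOn ℝ I)
    {γ : ℝ → E} (hγ : ContDiffOn ℝ (⊤ : ℕ∞) γ I) (hγC : ∀ t ∈ I, γ t ∈ C)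
    (hγ1 : ∀ t ∈ I, h (γ t) = 1) {b : ℝ} (hb : 0 ≤ b) (hbI : Icc 0 b ⊆ I) :
    ENNReal.ofReal (Real.log (fderiv ℝ h p (γ b)) - Real.log (fderiv ℝ h p (γ 0))) ≤
      ENNReal.ofReal √3 * ∫⁻ t in I, ENNReal.ofReal (√(-(1 / 3) *
        fderiv ℝ (fderiv ℝ h) (γ t) (derivWithin γ I t) (derivWithin γ I t))) := by
  have hderiv : ∀ t ∈ I, HasDerivWithinAt γ (derivWithin γ I t) I t := fun t ht =>
    ((hγ t ht).differentiableWithinAt (by simp)).hasDerivWithinAt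
  have hcont : ContinuousOn (derivWithin γ I) I := hγ.continuousOn_derivWithin hI (by simp)
  have hpos : ∀ t ∈ I, 0 < fderiv ℝ h p (γ t) := fun t ht =>
    hC.fderiv_pos hq hp (subset_closure (hγC t ht))
      (hq.ne_zero_of_pos (hC.pos _ (hγC t ht)))
  have htan : ∀ t ∈ I, fderiv ℝ h (γ t) (derivWithin γ I t) = 0 := by
    intro t ht
    have e1 := (hq.differentiable (γ t)).hasFDerivAt.comp_hasDerivWithinAt t (hderiv t ht)
    have e2 : HasDerivWithinAt (h ∘ γ) 0 I t :=
      (hasDerivWithinAt_const t I (1 : ℝ)).congr hγ1 (hγ1 t ht)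
    exact (hI t ht).eq_deriv _ e1 e2
  set u' : ℝ → ℝ := fun t => fderiv ℝ h p (derivWithin γ I t) / fderiv ℝ h p (γ t) with hu'
  have hu'cont : ContinuousOn u' (Icc 0 b) :=
    (((fderiv ℝ h p).continuous.comp_continuousOn hcont).div
      ((fderiv ℝ h p).continuous.comp_continuousOn hγ.continuousOn)
      (fun t ht => (hpos t ht).ne')).mono hbI
  have hint : ∫ t in (0 : ℝ)..b, u' t =
      Real.log (fderiv ℝ h p (γ b)) - Real.log (fderiv ℝ h p (γ 0)) := by
    refine intervalIntegral.integral_eq_sub_of_hasDerivAt_of_le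
      (f := fun t => Real.log (fderiv ℝ h p (γ t))) hb ?_ ?_ ?_
    · exact (((fderiv ℝ h p).continuous.comp_continuousOn hγ.continuousOn).log
        (fun t ht => (hpos t ht).ne')).mono hbI
    · intro t ht
      have htI := hbI (Ioo_subset_Icc_self ht)
      have hnhds : I ∈ 𝓝 t := mem_of_superset (Icc_mem_nhds ht.1 ht.2) hbI
      exact ((fderiv ℝ h p).hasFDerivAt.comp_hasDerivAt t
        ((hderiv t htI).hasDerivAt hnhds)).log (hpos t htI).ne'
    · exact hu'cont.intervalIntegrable_of_Icc hb
  have hpt : ∀ t ∈ I, ‖u' t‖ₑ ≤ ENNReal.ofReal √3 * ENNReal.ofReal (√(-(1 / 3) *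
      fderiv ℝ (fderiv ℝ h) (γ t) (derivWithin γ I t) (derivWithin γ I t))) := by
    intro t ht
    rw [Real.enorm_eq_ofReal_abs, ← ENNReal.ofReal_mul (Real.sqrt_nonneg _),
      ← Real.sqrt_mul (by norm_num)]
    refine ENNReal.ofReal_le_ofReal ?_
    rw [hu', abs_div, abs_of_pos (hpos t ht), div_le_iff₀ (hpos t ht)]
    rw [← mul_assoc, show (3 : ℝ) * -(1 / 3) = -1 by norm_num, neg_one_mul]
    exact hC.abs_fderiv_le hq hp (hγC t ht) (hγ1 t ht) (htan t ht)
  calc ENNReal.ofReal (Real.log (fderiv ℝ h p (γ b)) - Real.log (fderiv ℝ h p (γ 0)))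
      ≤ ‖∫ t in Ioc 0 b, u' t‖ₑ := by
        rw [← hint, intervalIntegral.integral_of_le hb]
        exact Real.ofReal_le_enorm _
    _ ≤ ∫⁻ t in Ioc 0 b, ‖u' t‖ₑ := enorm_integral_le_lintegral_enorm _
    _ ≤ ∫⁻ t in Ioc 0 b, ENNReal.ofReal √3 * ENNReal.ofReal (√(-(1 / 3) *
          fderiv ℝ (fderiv ℝ h) (γ t) (derivWithin γ I t) (derivWithin γ I t))) :=
        setLIntegral_mono' measurableSet_Ioc fun t ht => hpt t (hbI (Ioc_subset_Icc_self ht))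
    _ = ENNReal.ofReal √3 * ∫⁻ t in Ioc 0 b, ENNReal.ofReal (√(-(1 / 3) *
          fderiv ℝ (fderiv ℝ h) (γ t) (derivWithin γ I t) (derivWithin γ I t))) :=
        lintegral_const_mul' _ _ ENNReal.ofReal_ne_top
    _ ≤ _ := by
        gcongr
        exact Ioc_subset_Icc_self.trans hbI

/-- A curve of finite centroaffine length in a closed hyperbolic hypersurface stays in a compact
subset. -/
lemma exists_isCompact_of_length_ne_top [FiniteDimensional ℝ E] (hq : IsCubicForm h) {H W : Set E}
    (hW : IsOpen W) (hHW : H = W ∩ {x | h x = 1}) (hneg : HessianNegOn h H) (hH : IsClosed H)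
    {I : Set ℝ} (hI : UniqueDiffOn ℝ I) (hconn : I.OrdConnected) (h0 : 0 ∈ I)
    (hnonneg : ∀ t ∈ I, 0 ≤ t) {γ : ℝ → E} (hγ : ContDiffOn ℝ (⊤ : ℕ∞) γ I)
    (hγH : ∀ t ∈ I, γ t ∈ H)
    (hfin : ∫⁻ t in I, ENNReal.ofReal (√(-(1 / 3) *
      fderiv ℝ (fderiv ℝ h) (γ t) (derivWithin γ I t) (derivWithin γ I t))) ≠ ⊤) :
    ∃ K : Set E, IsCompact K ∧ K ⊆ H ∧ γ '' I ⊆ K := by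
  have hH1 : ∀ x ∈ H, h x = 1 := fun x hx => (hHW ▸ hx : x ∈ W ∩ {x | h x = 1}).2
  have hsub : H ⊆ coneOver h H := fun x hx =>
    ⟨by simp [hH1 x hx], by rwa [radialProj_of_eq_one (hH1 x hx)]⟩
  have hγ1 : ∀ t ∈ I, h (γ t) = 1 := fun t ht => hH1 _ (hγH t ht)
  set C := connectedComponentIn (coneOver h H) (γ 0) with hCdef
  have hC : IsHyperbolicCone h C := isHyperbolicCone_connectedComponentIn hq hW hHW hneg hH _
  have hγC : ∀ t ∈ I, γ t ∈ C := by
    have := (hconn.isPreconnected.image γ hγ.continuousOn).subset_connectedComponentIn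
      (mem_image_of_mem γ h0) ((image_subset_iff.2 hγH).trans hsub)
    exact fun t ht => this (mem_image_of_mem γ ht)
  have hp := hγC 0 h0
  obtain ⟨c, hc⟩ := hC.exists_norm_le hq hp
  set L := ENNReal.ofReal √3 * ∫⁻ t in I, ENNReal.ofReal (√(-(1 / 3) *
      fderiv ℝ (fderiv ℝ h) (γ t) (derivWithin γ I t) (derivWithin γ I t))) with hL
  have hLtop : L ≠ ⊤ := ENNReal.mul_ne_top ENNReal.ofReal_ne_top hfin
  set M := Real.exp (L.toReal + Real.log (fderiv ℝ h (γ 0) (γ 0))) with hM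
  have hbound : ∀ t ∈ I, ‖γ t‖ ≤ |c| * M := by
    intro t ht
    have hlog := hC.ofReal_log_sub_le hq hp hI hγ hγC hγ1 (hnonneg t ht) (hconn.out h0 ht)
    rw [ENNReal.ofReal_le_iff_le_toReal hLtop] at hlog
    have hpos := hC.fderiv_pos hq hp (subset_closure (hγC t ht))
      (hq.ne_zero_of_pos (hC.pos _ (hγC t ht)))
    have hle : fderiv ℝ h (γ 0) (γ t) ≤ M := (Real.log_le_iff_le_exp hpos).1 (by linarith)
    exact (hc _ (hγC t ht)).trans (mul_le_mul (le_abs_self c) hle hpos.le (abs_nonneg c))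
  have : ProperSpace E := FiniteDimensional.proper ℝ E
  refine ⟨Metric.closedBall 0 (|c| * M) ∩ H, (isCompact_closedBall _ _).inter_right hH,
    inter_subset_right, ?_⟩
  rintro _ ⟨t, ht, rfl⟩
  exact ⟨by simpa using hbound t ht, hγH t ht⟩

/-- A non-closed relatively open subset of the level set contains a curve of finite centroaffine
length which is not contained in a compact subset. -/
lemma exists_curve_of_not_isClosed (hq : IsCubicForm h) {H W : Set E} (hW : IsOpen W)
    (hHW : H = W ∩ {x | h x = 1}) (hH : ¬ IsClosed H) :
    ∃ T : ℝ, 0 < T ∧ ∃ γ : ℝ → E, ContDiffOn ℝ (⊤ : ℕ∞) γ (Ico 0 T) ∧ (∀ t ∈ Ico 0 T, γ t ∈ H) ∧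
      (¬ ∃ K : Set E, IsCompact K ∧ K ⊆ H ∧ γ '' Ico 0 T ⊆ K) ∧
      ∫⁻ t in Ico 0 T, ENNReal.ofReal (√(-(1 / 3) * fderiv ℝ (fderiv ℝ h) (γ t)
        (derivWithin γ (Ico 0 T) t) (derivWithin γ (Ico 0 T) t))) ≠ ⊤ := by
  have hH1 : H ⊆ {x | h x = 1} := hHW ▸ inter_subset_right
  obtain ⟨p, hpcl, hpH⟩ : ∃ p ∈ closure H, p ∉ H := by
    by_contra! hall
    exact hH (isClosed_of_closure_subset hall)
  have hp1 : h p = 1 :=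
    closure_minimal hH1 (isClosed_eq hq.continuous continuous_const) hpcl
  have hpW : p ∉ W := fun hW' => hpH (hHW ▸ ⟨hW', hp1⟩)
  obtain ⟨r, hr, hball⟩ := Metric.isOpen_iff.1 (isOpen_lt continuous_const hq.continuous) p
    (show 0 < h p by simp [hp1])
  obtain ⟨q, hqH, hqr⟩ := Metric.mem_closure_iff.1 hpcl r hr
  have hc : ContDiff ℝ (⊤ : ℕ∞) fun t : ℝ => q + t • (p - q) := by fun_prop
  have hpos : ∀ t ∈ Icc (0 : ℝ) 1, 0 < h (q + t • (p - q)) := fun t ht =>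
    hball ((convex_ball p r).add_smul_sub_mem (by rwa [Metric.mem_ball']) (Metric.mem_ball_self hr)
      ht)
  set γ : ℝ → E := fun t => radialProj h (q + t • (p - q)) with hγ
  set O : Set ℝ := {t | 0 < h (q + t • (p - q))} with hO
  have hOopen : IsOpen O := isOpen_lt continuous_const (hq.continuous.comp hc.continuous)
  have hγO : ContDiffOn ℝ (⊤ : ℕ∞) γ O := fun t ht =>
    (ContDiffAt.comp (g := radialProj h) (f := fun t : ℝ => q + t • (p - q)) t
      (hq.contDiffAt_radialProj ht) hc.contDiffAt).contDiffWithinAt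
  have hγ0 : γ 0 = q := by simp [hγ, radialProj_of_eq_one (hH1 hqH)]
  have hγ1 : γ 1 = p := by simp [hγ, radialProj_of_eq_one hp1]
  have hcontI : ContinuousOn γ (Icc 0 1) := hγO.continuousOn.mono hpos
  set S : Set ℝ := Icc 0 1 ∩ γ ⁻¹' Wᶜ with hS
  have hScl : IsClosed S := hcontI.preimage_isClosed_of_isClosed isClosed_Icc hW.isClosed_compl
  have hSbdd : BddBelow S := ⟨0, fun t ht => ht.1.1⟩
  have hmem : sInf S ∈ S := hScl.csInf_mem
    ⟨1, by simp, by simpa [hγ1] using hpW⟩ hSbdd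
  have hT : 0 < sInf S := by
    refine hmem.1.1.lt_of_ne fun h0 => hmem.2 ?_
    rw [← h0, hγ0]
    exact (hHW ▸ hqH : q ∈ W ∩ {x | h x = 1}).1
  set T := sInf S with hTdef
  have hsubO : Icc 0 T ⊆ O := fun t ht => hpos t ⟨ht.1, ht.2.trans hmem.1.2⟩
  refine ⟨T, hT, γ, hγO.mono (Ico_subset_Icc_self.trans hsubO), ?_, ?_, ?_⟩
  · intro t ht
    rw [hHW]
    refine ⟨?_, hq.map_radialProj (hsubO (Ico_subset_Icc_self ht))⟩
    by_contra hn
    exact notMem_of_lt_csInf ht.2 hSbdd ⟨⟨ht.1, ht.2.le.trans hmem.1.2⟩, hn⟩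
  · rintro ⟨K, hK, hKH, hsub⟩
    have hTO : T ∈ O := hsubO ⟨hT.le, le_rfl⟩
    have : γ T ∈ K := by
      have hcl : T ∈ closure (Ico 0 T) := by
        rw [closure_Ico hT.ne]
        exact ⟨hT.le, le_rfl⟩
      have := ((hγO T hTO).contDiffAt (hOopen.mem_nhds hTO)).continuousAt.continuousWithinAt
        |>.mem_closure_image hcl
      exact closure_minimal hsub hK.isClosed this
    exact hmem.2 (hHW ▸ hKH this : γ T ∈ W ∩ {x | h x = 1}).1
  · set F : ℝ → ℝ := fun t =>
      √(-(1 / 3) * fderiv ℝ (fderiv ℝ h) (γ t) (deriv γ t) (deriv γ t)) with hF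
    have hderiv : ContinuousOn (deriv γ) O := hγO.continuousOn_deriv_of_isOpen hOopen (by simp)
    have hD2 : Continuous (fderiv ℝ (fderiv ℝ h)) := hq.contDiff_fderiv.continuous_fderiv (by simp)
    have hFcont : ContinuousOn F (Icc 0 T) :=
      ((continuousOn_const.mul (((hD2.comp_continuousOn hγO.continuousOn).clm_apply
        hderiv).clm_apply hderiv)).sqrt).mono hsubO
    obtain ⟨M, hM⟩ := isCompact_Icc.exists_bound_of_continuousOn hFcont
    refine ne_top_of_le_ne_top (b := ∫⁻ _ in Ico 0 T, ENNReal.ofReal M) ?_ ?_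
    · simp [ENNReal.mul_ne_top]
    · refine setLIntegral_mono' measurableSet_Ico fun t ht => ENNReal.ofReal_le_ofReal ?_
      have htO := hsubO (Ico_subset_Icc_self ht)
      have hd : DifferentiableAt ℝ γ t :=
        ((hγO t htO).contDiffAt (hOopen.mem_nhds htO)).differentiableAt (by simp)
      rw [hd.derivWithin (uniqueDiffOn_Ico 0 T t ht)]
      exact (le_abs_self _).trans (hM t (Ico_subset_Icc_self ht))

end Length

/-- main theorem: A projective special real manifold `H` (a nonempty
smooth hypersurface contained in `{h = 1}` for a homogeneous cubic polynomial `h`,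
with Hessian of `h` negative definite on the tangent spaces `ker Dh_p`) is a closed
subset of `ℝ^{n+1}` if and only if it is complete with respect to the centroaffine
metric, i.e. every smooth curve `γ : [0,T) → H` that is not contained in any
compact subset of `H` has infinite centroaffine length.

Since `Dh_p(p) = 3 ≠ 0` on `{h = 1}`, a smooth hypersurface contained in the level
set is the same as an open subset of the level set; we formalize it this way. -/
theorem stmt_7 (n : ℕ)
    (P : MvPolynomial (Fin (n + 1)) ℝ) (hP : P.IsHomogeneous 3)
    (h : EuclideanSpace ℝ (Fin (n + 1)) → ℝ)
    (hh : ∀ x, h x = MvPolynomial.eval (fun i => x i) P)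
    (H : Set (EuclideanSpace ℝ (Fin (n + 1))))
    (hne : H.Nonempty)
    (hhyper : ∃ W : Set (EuclideanSpace ℝ (Fin (n + 1))), IsOpen W ∧
      H = W ∩ {x | h x = 1})
    (hhyp : ∀ p ∈ H, ∀ v : EuclideanSpace ℝ (Fin (n + 1)),
      fderiv ℝ h p v = 0 → v ≠ 0 → fderiv ℝ (fderiv ℝ h) p v v < 0) :
    IsClosed H ↔
      ∀ T : ℝ≥0∞, 0 < T →
        ∀ γ : ℝ → EuclideanSpace ℝ (Fin (n + 1)),
          ContDiffOn ℝ (⊤ : ℕ∞) γ {t : ℝ | 0 ≤ t ∧ ENNReal.ofReal t < T} →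
          (∀ t, 0 ≤ t → ENNReal.ofReal t < T → γ t ∈ H) →
          (¬ ∃ K : Set (EuclideanSpace ℝ (Fin (n + 1))), IsCompact K ∧ K ⊆ H ∧
            γ '' {t : ℝ | 0 ≤ t ∧ ENNReal.ofReal t < T} ⊆ K) →
          ∫⁻ t in {t : ℝ | 0 ≤ t ∧ ENNReal.ofReal t < T},
            ENNReal.ofReal (Real.sqrt (-(1 / 3) *
              fderiv ℝ (fderiv ℝ h) (γ t)
                (derivWithin γ {t : ℝ | 0 ≤ t ∧ ENNReal.ofReal t < T} t)
                (derivWithin γ {t : ℝ | 0 ≤ t ∧ ENNReal.ofReal t < T} t))) = ⊤ := by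
  have hq := isCubicForm_eval P hP h hh
  obtain ⟨W, hW, hHW⟩ := hhyper
  constructor
  · intro hH T hT γ hγ hγH hK
    by_contra hfin
    set I : Set ℝ := {t : ℝ | 0 ≤ t ∧ ENNReal.ofReal t < T} with hI
    have hord : I.OrdConnected := ⟨fun a ha b hb t ht =>
      ⟨ha.1.trans ht.1, (ENNReal.ofReal_le_ofReal ht.2).trans_lt hb.2⟩⟩
    have h0 : (0 : ℝ) ∈ I := ⟨le_rfl, by simpa using hT⟩
    have hint : (interior I).Nonempty := by
      obtain ⟨b, hb0, hbT⟩ := ENNReal.lt_iff_exists_nnreal_btwn.1 hT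
      have hb : (0 : ℝ) < b := by exact_mod_cast hb0
      have hbI : (b : ℝ) ∈ I := ⟨hb.le, by simpa using hbT⟩
      refine (nonempty_Ioo.2 hb).mono (interior_maximal ?_ isOpen_Ioo)
      exact Ioo_subset_Icc_self.trans (hord.out h0 hbI)
    exact hK (exists_isCompact_of_length_ne_top hq hW hHW hhyp hH
      (uniqueDiffOn_convex hord.convex hint) hord h0 (fun t ht => ht.1) hγ
      (fun t ht => hγH t ht.1 ht.2) hfin)
  · intro hcomplete
    by_contra hH
    obtain ⟨T, hT, γ, hγ, hγH, hK, hfin⟩ := exists_curve_of_not_isClosed hq hW hHW hH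
    have hIco : {t : ℝ | 0 ≤ t ∧ ENNReal.ofReal t < ENNReal.ofReal T} = Ico 0 T := by
      ext t
      exact and_congr_right fun _ => ENNReal.ofReal_lt_ofReal_iff hT
    have := hcomplete (ENNReal.ofReal T) (by simpa using hT) γ
    rw [hIco] at this
    exact hfin (this hγ (fun t h0 hlt => hγH t ⟨h0, (ENNReal.ofReal_lt_ofReal_iff hT).1 hlt⟩) hK)
end

section
/- Let h₀ : ℝ → ℝ be a polynomial function of degree at most 3 and let a < b be real numbers such that h₀(t) > 0 for all t ∈ (a, b) and h₀(a) = h₀(b) = 0. Then 2·h₀(t)·h₀''(t) ≤ (h₀'(t))² for all t ∈ (a, b); consequently the function t ↦ √(h₀(t)) is concave on (a, b). -/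
open Set

/-- The square root of a positive function on a convex set is concave as soon as
`2 f f'' ≤ f' ^ 2`. -/
theorem concaveOn_sqrt_of_hasDerivAt {D : Set ℝ} (hD : Convex ℝ D)
    {f f' f'' : ℝ → ℝ} (hf : ∀ t ∈ D, HasDerivAt f (f' t) t)
    (hf' : ∀ t ∈ D, HasDerivAt f' (f'' t) t) (hpos : ∀ t ∈ D, 0 < f t)
    (h : ∀ t ∈ D, 2 * f t * f'' t ≤ f' t ^ 2) :
    ConcaveOn ℝ D (fun t => √(f t)) := by
  have h1 : ∀ t ∈ D, HasDerivAt (fun t => √(f t)) (f' t / (2 * √(f t))) t :=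
    fun t ht => (hf t ht).sqrt (hpos t ht).ne'
  have hs : ∀ t ∈ D, 0 < √(f t) := fun t ht => Real.sqrt_pos.2 (hpos t ht)
  have h2 : ∀ t ∈ D, HasDerivAt (fun t => f' t / (2 * √(f t)))
      ((2 * f t * f'' t - f' t ^ 2) / (4 * √(f t) ^ 3)) t := by
    intro t ht
    have hst := hs t ht
    refine ((hf' t ht).div ((h1 t ht).const_mul 2) (by positivity)).congr_deriv ?_
    have hsq : f t = √(f t) ^ 2 := (Real.sq_sqrt (hpos t ht).le).symm
    generalize √(f t) = s at *
    rw [hsq]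
    field_simp
    ring
  refine concaveOn_of_hasDerivWithinAt2_nonpos hD
    (fun t ht => (h1 t ht).continuousAt.continuousWithinAt)
    (fun t ht => (h1 t (interior_subset ht)).hasDerivWithinAt)
    (fun t ht => (h2 t (interior_subset ht)).hasDerivWithinAt) fun t ht => ?_
  have hst := hs t (interior_subset ht)
  exact div_nonpos_of_nonpos_of_nonneg (sub_nonpos.2 (h t (interior_subset ht))) (by positivity)

/-- A polynomial of degree at most `3` with distinct roots `a` and `b` is the product of
`(t - a) * (b - t)` and an affine function. -/
theorem Polynomial.exists_eval_eq_mul_affine {P : Polynomial ℝ} (hdeg : P.degree ≤ 3) {a b : ℝ}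
    (hab : a ≠ b) (ha : P.eval a = 0) (hb : P.eval b = 0) :
    ∃ c d : ℝ, ∀ t, P.eval t = (t - a) * (b - t) * (c + d * t) := by
  have hnat : P.natDegree < 4 := Nat.lt_succ_of_le (Polynomial.natDegree_le_of_degree_le hdeg)
  have hev (t : ℝ) :
      P.eval t = P.coeff 0 + P.coeff 1 * t + P.coeff 2 * t ^ 2 + P.coeff 3 * t ^ 3 := by
    simp [Polynomial.eval_eq_sum_range' hnat, Finset.sum_range_succ]
  rw [hev] at ha hb
  have h1 : P.coeff 1 + P.coeff 2 * (a + b) + P.coeff 3 * (a ^ 2 + a * b + b ^ 2) = 0 :=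
    mul_left_cancel₀ (sub_ne_zero.2 hab) (by linear_combination ha - hb)
  refine ⟨-(P.coeff 2 + P.coeff 3 * (a + b)), -P.coeff 3, fun t => ?_⟩
  rw [hev]
  linear_combination ha + (t - a) * h1

/-- one-variable key lemma: If `h₀` is a polynomial function of
degree at most 3 which is positive on `(a,b)` and vanishes at `a` and `b`, then
`2·h₀·h₀'' ≤ (h₀')²` on `(a,b)`, and consequently `√h₀` is concave on `(a,b)`. -/
theorem stmt_8 (h₀ : ℝ → ℝ) (P : Polynomial ℝ) (hdeg : P.degree ≤ 3)
    (hP : ∀ t, h₀ t = P.eval t)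
    (a b : ℝ) (hab : a < b)
    (hpos : ∀ t ∈ Ioo a b, 0 < h₀ t)
    (ha : h₀ a = 0) (hb : h₀ b = 0) :
    (∀ t ∈ Ioo a b, 2 * h₀ t * deriv (deriv h₀) t ≤ (deriv h₀ t) ^ 2) ∧
    ConcaveOn ℝ (Ioo a b) (fun t => Real.sqrt (h₀ t)) := by
  obtain ⟨c, d, hcd⟩ :=
    Polynomial.exists_eval_eq_mul_affine hdeg hab.ne (hP a ▸ ha) (hP b ▸ hb)
  have hfun : h₀ = fun t => (t - a) * (b - t) * (c + d * t) := funext fun t => (hP t).trans (hcd t)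
  have hq (t : ℝ) : HasDerivAt (fun t => (t - a) * (b - t)) (a + b - 2 * t) t :=
    (((hasDerivAt_id' t).sub_const a).mul ((hasDerivAt_id' t).const_sub b)).congr_deriv (by ring)
  have hl (t : ℝ) : HasDerivAt (fun t => c + d * t) d t :=
    (((hasDerivAt_id' t).const_mul d).const_add c).congr_deriv (by ring)
  have hd1 (t : ℝ) : HasDerivAt h₀
      ((a + b - 2 * t) * (c + d * t) + (t - a) * (b - t) * d) t := by
    rw [hfun]
    exact (hq t).mul (hl t)
  have hd2 (t : ℝ) : HasDerivAt (deriv h₀) (-2 * (c + d * t) + 2 * ((a + b - 2 * t) * d)) t := by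
    rw [funext fun t => (hd1 t).deriv]
    exact (((((hasDerivAt_id' t).const_mul 2).const_sub (a + b)).mul (hl t)).add
      ((hq t).mul_const d)).congr_deriv (by ring)
  have key : ∀ t ∈ Ioo a b, 2 * h₀ t * deriv (deriv h₀) t ≤ (deriv h₀ t) ^ 2 := by
    intro t ht
    rw [(hd2 t).deriv, (hd1 t).deriv, hfun]
    have hq0 : 0 ≤ (t - a) * (b - t) :=
      mul_nonneg (sub_nonneg.2 ht.1.le) (sub_nonneg.2 ht.2.le)
    have h1 := mul_nonneg hq0 (sq_nonneg (c + d * t))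
    have h2 := sq_nonneg ((t - a) * (b - t) * d - (a + b - 2 * t) * (c + d * t))
    linear_combination 4 * h1 + h2
  exact ⟨key, concaveOn_sqrt_of_hasDerivAt (convex_Ioo a b)
    (fun t _ => (hd1 t).differentiableAt.hasDerivAt)
    (fun t _ => (hd2 t).differentiableAt.hasDerivAt) hpos key⟩
end
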